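/- Let d_1, …, d_s ≥ 2 and d := d_1 + ⋯ + d_s with d ≤ 2n − s − 2. Then for a general tuple (f_1,…,f_s) in the parameter space ⊕_{i=1}^s Sym^{d_i}(V*) (V = ℂ^{n+1}), i.e., for all tuples in a dense Zariski-open subset, the complete intersection X = V(f_1,…,f_s) ⊂ ℙ^n has Fano variety of lines F(X) of dimension exactly 2n − d − s − 2. -/

import Mathlib

/-! Formalization of: for degrees d_1,…,d_s ≥ 2 with d := Σ d_i ≤ 2n − s − 2, a general
tuple (f_1,…,f_s) of homogeneous polynomials of these degrees cuts out X = V(f_1,…,f_s) ⊆ ℙ^n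
whose Fano variety of lines has dimension exactly 2n − d − s − 2. -/

noncomputable section

/-- The Zariski topology on complex projective `n`-space `ℙ(ℂ^{n+1})`: it is generated by the
complements of the zero loci of homogeneous polynomials. -/
instance projZariski (n : ℕ) : TopologicalSpace (Projectivization ℂ (Fin (n + 1) → ℂ)) :=
  TopologicalSpace.generateFrom
    {U | ∃ (k : ℕ) (f : MvPolynomial (Fin (n + 1)) ℂ), f.IsHomogeneous k ∧
      U = {x | MvPolynomial.eval x.rep f ≠ 0}}

/-- The Grassmannian `G(1,n)` of projective lines in `ℙ^n`, i.e. the set of 2-dimensional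
linear subspaces of `ℂ^{n+1}`. -/
def ProjLine (n : ℕ) : Type :=
  {W : Submodule ℂ (Fin (n + 1) → ℂ) // Module.finrank ℂ W = 2}

/-- The Zariski topology on the Grassmannian of lines: it is generated by the complements of
the loci of lines `ℙ(W)` on which a fixed polynomial in two vector arguments vanishes
identically on `W × W` (e.g. polynomials in the Plücker coordinates). -/
instance grassZariski (n : ℕ) : TopologicalSpace (ProjLine n) :=
  TopologicalSpace.generateFrom
    {U | ∃ F : MvPolynomial (Fin (n + 1) ⊕ Fin (n + 1)) ℂ,
      U = {W : ProjLine n | ¬ ∀ u ∈ W.1, ∀ v ∈ W.1, MvPolynomial.eval (Sum.elim u v) F = 0}}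

/-- The projective line `ℙ(W) ⊆ ℙ^n` associated to a linear subspace `W ⊆ ℂ^{n+1}`,
as a set of points of `ℙ^n`. -/
def lineSet {n : ℕ} (W : Submodule ℂ (Fin (n + 1) → ℂ)) :
    Set (Projectivization ℂ (Fin (n + 1) → ℂ)) :=
  {x | x.rep ∈ W}

/-- The Fano variety of lines of `X ⊆ ℙ^n`: the subset of the Grassmannian of lines
consisting of the lines contained in `X`. -/
def fanoLines {n : ℕ} (X : Set (Projectivization ℂ (Fin (n + 1) → ℂ))) : Set (ProjLine n) :=
  {W | lineSet W.1 ⊆ X}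

/-- `X ⊆ ℙ^n` is a smooth complete intersection of the `s` hypersurfaces of degrees
`d 0, …, d (s-1)` cut out by the homogeneous polynomials `f 0, …, f (s-1)`:  each `f i` is
homogeneous of degree `d i ≥ 2`, `X` is the common zero locus of the `f i`, `X` has
codimension `s` (i.e. dimension `n - s`), and the Jacobian matrix `(∂f_i/∂x_j)` has rank `s`
at every point of (the affine cone over) `X`. -/
structure IsSmoothCI (n s : ℕ) (d : Fin s → ℕ) (f : Fin s → MvPolynomial (Fin (n + 1)) ℂ)
    (X : Set (Projectivization ℂ (Fin (n + 1) → ℂ))) : Prop where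
  two_le_deg : ∀ i, 2 ≤ d i
  homog : ∀ i, (f i).IsHomogeneous (d i)
  locus : X = {x | ∀ i, MvPolynomial.eval x.rep (f i) = 0}
  codim : topologicalKrullDim ↥X = ((n - s : ℕ) : WithBot ℕ∞)
  smooth : ∀ v : Fin (n + 1) → ℂ, v ≠ 0 → (∀ i, MvPolynomial.eval v (f i) = 0) →
    (Matrix.of fun i j => MvPolynomial.eval v (MvPolynomial.pderiv j (f i))).rank = s

/-- The common zero locus `V(f_1, …, f_s) ⊆ ℙ^n` of a tuple of polynomials. -/
def projZeroLocus {n s : ℕ} (f : Fin s → MvPolynomial (Fin (n + 1)) ℂ) :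
    Set (Projectivization ℂ (Fin (n + 1) → ℂ)) :=
  {x | ∀ i, MvPolynomial.eval x.rep (f i) = 0}

/-- `P` holds for a *general* tuple `(f_1, …, f_s)` of homogeneous polynomials of degrees
`(d_1, …, d_s)` (a general point of the parameter space `⊕_i Sym^{d_i}(V*)`, `V = ℂ^{n+1}`):
there is a polynomial condition `g` on the coefficients of the tuple which is nonzero at some
tuple of homogeneous polynomials of the given degrees (so the corresponding basic open subset
of the parameter space is nonempty, hence dense), and `P` holds at every tuple of homogeneous
polynomials of the given degrees where `g` does not vanish. -/
def GenericHolds (n : ℕ) {s : ℕ} (d : Fin s → ℕ)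
    (P : (Fin s → MvPolynomial (Fin (n + 1)) ℂ) → Prop) : Prop :=
  ∃ g : MvPolynomial (Fin s × ((Fin (n + 1)) →₀ ℕ)) ℂ,
    (∃ f₀ : Fin s → MvPolynomial (Fin (n + 1)) ℂ, (∀ i, (f₀ i).IsHomogeneous (d i)) ∧
      MvPolynomial.eval (fun p => MvPolynomial.coeff p.2 (f₀ p.1)) g ≠ 0) ∧
    (∀ f : Fin s → MvPolynomial (Fin (n + 1)) ℂ, (∀ i, (f i).IsHomogeneous (d i)) →
      MvPolynomial.eval (fun p => MvPolynomial.coeff p.2 (f p.1)) g ≠ 0 → P f)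

section helpers

open MvPolynomial

theorem ringKrullDim_integral_inj {R S : Type*} [CommRing R] [CommRing S] [Algebra R S]
    [Algebra.IsIntegral R S] (hinj : Function.Injective (algebraMap R S)) :
    ringKrullDim S = ringKrullDim R := by
  apply le_antisymm
  · refine Order.krullDim_le_of_strictMono (PrimeSpectrum.comap (algebraMap R S)) ?_
    intro p q h
    exact Ideal.IsIntegral.comap_lt_comap (R := R) (I := p.asIdeal) (J := q.asIdeal) h
  · refine iSup_le fun l => ?_
    have : FaithfulSMul R S := (faithfulSMul_iff_algebraMap_injective R S).mpr hinj
    obtain ⟨⟨P, hP1, hP2⟩⟩ := Ideal.nonempty_primesOver (S := S) (RelSeries.head l).asIdeal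
    obtain ⟨L, hL, -⟩ := Ideal.exists_ltSeries_of_hasGoingUp (S := S) l P
    rw [← hL]
    exact le_iSup (fun l : LTSeries (PrimeSpectrum S) => ((l.length : ℕ∞) : WithBot ℕ∞)) L

theorem relNoether (B C : Type) [CommRing B] [IsDomain B] [CommRing C] [IsDomain C]
    [Algebra B C] [FaithfulSMul B C] [Algebra.FiniteType B C] :
    ∃ r, ∃ t : Fin r → C, AlgebraicIndependent B t ∧ ∀ x : C, ∃ g : B, g ≠ 0 ∧
      (aeval (R := B) t).toRingHom.IsIntegralElem (algebraMap B C g * x) := by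
  let K := FractionRing B
  let A := TensorProduct B K C
  let : Algebra C A := Algebra.TensorProduct.rightAlgebra
  have hloc : IsLocalization (Algebra.algebraMapSubmonoid C (nonZeroDivisors B)) A := inferInstance
  have hle : Algebra.algebraMapSubmonoid C (nonZeroDivisors B) ≤ nonZeroDivisors C := by
    rintro _ ⟨b, hb, rfl⟩
    rw [mem_nonZeroDivisors_iff_ne_zero]
    simpa using nonZeroDivisors.ne_zero hb
  have hCA : Function.Injective (algebraMap C A) := IsLocalization.injective A hle
  have : Nontrivial A := hCA.nontrivial
  have hst : IsScalarTower B C A := inferInstance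
  obtain ⟨r, θ, hθ, hθi⟩ := exists_integral_inj_algHom_of_fg K A
  have hsurj : ∀ i, ∃ c : C, ∃ b : B, b ≠ 0 ∧ algebraMap C A c = algebraMap B A b * θ (X i) := by
    intro i
    obtain ⟨⟨c, ⟨_, b, hb, rfl⟩⟩, h⟩ := IsLocalization.surj (Algebra.algebraMapSubmonoid C (nonZeroDivisors B)) (θ (X i))
    refine ⟨c, b, nonZeroDivisors.ne_zero hb, ?_⟩
    rw [← h, IsScalarTower.algebraMap_apply B C A, mul_comm]
  choose c b hb hc using hsurj
  have hbK : ∀ i, algebraMap B K (b i) ≠ 0 := fun i => by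
    simpa using hb i
  let S : MvPolynomial (Fin r) K →ₐ[K] MvPolynomial (Fin r) K :=
    aeval (fun i => MvPolynomial.C (algebraMap B K (b i)) * X i)
  let S' : MvPolynomial (Fin r) K →ₐ[K] MvPolynomial (Fin r) K :=
    aeval (fun i => MvPolynomial.C (algebraMap B K (b i))⁻¹ * X i)
  have h1 : S'.comp S = AlgHom.id K _ := by
    ext1 i
    simp only [S, S', AlgHom.comp_apply, aeval_X, map_mul, algHom_C, AlgHom.id_apply]
    rw [MvPolynomial.algebraMap_eq, ← mul_assoc, ← map_mul, mul_inv_cancel₀ (hbK i), map_one, one_mul]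
  have h2 : S.comp S' = AlgHom.id K _ := by
    ext1 i
    simp only [S, S', AlgHom.comp_apply, aeval_X, map_mul, algHom_C, AlgHom.id_apply]
    rw [MvPolynomial.algebraMap_eq, ← mul_assoc, ← map_mul, inv_mul_cancel₀ (hbK i), map_one, one_mul]
  have hSinj : Function.Injective S := fun x y h => by
    have := congrArg S' h
    simpa only [← AlgHom.comp_apply, h1, AlgHom.id_apply] using this
  have hSsurj : Function.Surjective S := fun x => ⟨S' x, by
    rw [← AlgHom.comp_apply, h2, AlgHom.id_apply]⟩
  let θ' := θ.comp S
  have hθ' : Function.Injective θ' := hθ.comp hSinj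
  have hθi' : θ'.toRingHom.IsIntegral :=
    RingHom.IsIntegral.trans S.toRingHom θ.toRingHom (RingHom.isIntegral_of_surjective _ hSsurj) hθi
  -- commutative square
  have hsq : ∀ p : MvPolynomial (Fin r) B,
      θ' (MvPolynomial.map (algebraMap B K) p) = algebraMap C A (aeval c p) := by
    intro p
    have : (θ'.toRingHom.comp (MvPolynomial.map (algebraMap B K))) =
        (algebraMap C A).comp (aeval (R := B) c).toRingHom := by
      refine MvPolynomial.ringHom_ext ?_ ?_
      · intro x
        simp [θ', S, ← IsScalarTower.algebraMap_apply]
      · intro i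
        simp [θ', S, hc]
        rw [← IsScalarTower.algebraMap_apply B K A]
    exact congrArg (fun f => f p) this
  refine ⟨r, c, ?_, ?_⟩
  · rw [AlgebraicIndependent]
    have : Function.Injective (fun p => algebraMap C A (aeval (R := B) c p)) := by
      simp_rw [← hsq]
      exact hθ'.comp (MvPolynomial.map_injective _ (IsFractionRing.injective B K))
    exact Function.Injective.of_comp this
  · intro x
    let : Algebra (MvPolynomial (Fin r) B) (MvPolynomial (Fin r) K) := MvPolynomial.algebraMvPolynomial
    let : Algebra (MvPolynomial (Fin r) K) A := θ'.toRingHom.toAlgebra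
    let : Algebra (MvPolynomial (Fin r) B) A := ((algebraMap C A).comp (aeval (R := B) c).toRingHom).toAlgebra
    let : Algebra (MvPolynomial (Fin r) B) C := (aeval (R := B) c).toRingHom.toAlgebra
    have : IsScalarTower (MvPolynomial (Fin r) B) C A := IsScalarTower.of_algebraMap_eq (fun _ => rfl)
    have : IsScalarTower (MvPolynomial (Fin r) B) (MvPolynomial (Fin r) K) A :=
      IsScalarTower.of_algebraMap_eq (fun p => (hsq p).symm)
    have hx : IsIntegral (MvPolynomial (Fin r) K) (algebraMap C A x) := hθi' _
    obtain ⟨⟨_, g, hg, rfl⟩, hm⟩ := IsIntegral.exists_multiple_integral_of_isLocalization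
      (R := MvPolynomial (Fin r) B)
      ((nonZeroDivisors B).map (MvPolynomial.C (σ := Fin r))) (algebraMap C A x) hx
    refine ⟨g, nonZeroDivisors.ne_zero hg, ?_⟩
    have heq : (⟨MvPolynomial.C g, ⟨g, hg, rfl⟩⟩ :
        (nonZeroDivisors B).map (MvPolynomial.C (σ := Fin r))) • (algebraMap C A x) =
        algebraMap C A (algebraMap B C g * x) := by
      rw [Submonoid.smul_def, Algebra.smul_def, map_mul]
      congr 1
      change algebraMap C A (aeval c (MvPolynomial.C g)) = _
      simp
    rw [heq] at hm
    exact (isIntegral_algebraMap_iff hCA).mp hm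

theorem lift_point {ρ R : Type} [CommRing R] [Algebra ℂ R]
    (α : R →ₐ[ℂ] MvPolynomial ρ ℂ) (hα : Function.Injective α) (χ₀ : R →ₐ[ℂ] ℂ) (g : R)
    (hg : χ₀ g ≠ 0) (hInt : ∀ j, α.toRingHom.IsIntegralElem (α g * X j)) :
    ∃ y : ρ → ℂ, ∀ p, eval y (α p) = χ₀ p := by
  let _ : Algebra R (MvPolynomial ρ ℂ) := α.toRingHom.toAlgebra
  have : IsScalarTower ℂ R (MvPolynomial ρ ℂ) :=
    IsScalarTower.of_algebraMap_eq (fun c => (α.commutes c).symm)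
  let C' := integralClosure R (MvPolynomial ρ ℂ)
  have hRC : Function.Injective (algebraMap R C') := fun x y h =>
    hα (congrArg (fun z : C' => (z : MvPolynomial ρ ℂ)) h)
  have hmax : (RingHom.ker χ₀.toRingHom).IsMaximal :=
    RingHom.ker_isMaximal_of_surjective _ (fun c => ⟨algebraMap ℂ R c, χ₀.commutes c⟩)
  obtain ⟨Q, hQ, hQc⟩ := Ideal.exists_ideal_over_maximal_of_isIntegral (S := C')
    (RingHom.ker χ₀.toRingHom) (by
      rw [(RingHom.injective_iff_ker_eq_bot _).mp hRC]; exact bot_le)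
  let F := C' ⧸ Q
  have hdom : IsDomain F := Ideal.Quotient.isDomain Q
  have hcomp : (algebraMap ℂ F).comp χ₀.toRingHom =
      (Ideal.Quotient.mk Q).comp (algebraMap R C') := by
    ext p
    have h1 : p - algebraMap ℂ R (χ₀ p) ∈ RingHom.ker χ₀.toRingHom := by
      rw [RingHom.mem_ker]
      simp
    rw [← hQc, Ideal.mem_comap, map_sub, ← IsScalarTower.algebraMap_apply] at h1
    have h2 := (Ideal.Quotient.eq (I := Q)).mpr h1
    exact h2.symm
  have hInt' : Algebra.IsIntegral ℂ F := by
    refine ⟨fun q => ?_⟩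
    obtain ⟨c, rfl⟩ := Ideal.Quotient.mk_surjective q
    have hc : IsIntegral R c := Algebra.IsIntegral.isIntegral c
    exact hc.map_of_comp_eq χ₀.toRingHom (Ideal.Quotient.mk Q) hcomp
  have hbij : Function.Bijective (algebraMap ℂ F) :=
    IsAlgClosed.algebraMap_bijective_of_isIntegral
  let e := RingEquiv.ofBijective (algebraMap ℂ F) hbij
  let χ : C' →+* ℂ := (e.symm : F →+* ℂ).comp (Ideal.Quotient.mk Q)
  have hχ : ∀ p : R, χ (algebraMap R C' p) = χ₀ p := by
    intro p
    change e.symm (((Ideal.Quotient.mk Q).comp (algebraMap R C')) p) = _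
    rw [← hcomp]
    exact e.symm_apply_apply _
  let y : ρ → ℂ := fun j => χ ⟨α g * X j, hInt j⟩ / χ₀ g
  have key : ∀ P : MvPolynomial ρ ℂ, ∃ D : ℕ, ∃ c : C', (c : MvPolynomial ρ ℂ) = (α g) ^ D * P ∧
      χ c = (χ₀ g) ^ D * eval y P := by
    intro P
    induction P using MvPolynomial.induction_on with
    | C a =>
      refine ⟨0, algebraMap R C' (algebraMap ℂ R a), ?_, ?_⟩
      · change α (algebraMap ℂ R a) = _
        simp
      · rw [hχ]; simp
    | add P Q hP hQ =>
      obtain ⟨D, c, h1, h2⟩ := hP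
      obtain ⟨D', c', h1', h2'⟩ := hQ
      refine ⟨D + D', algebraMap R C' (g ^ D') * c + algebraMap R C' (g ^ D) * c', ?_, ?_⟩
      · change α (g ^ D') * (c : MvPolynomial ρ ℂ) + α (g ^ D) * (c' : MvPolynomial ρ ℂ) = _
        rw [h1, h1', map_pow, map_pow]; ring
      · rw [map_add, map_mul, map_mul, hχ, hχ, h2, h2', map_pow, map_pow, map_add]; ring
    | mul_X P j hP =>
      obtain ⟨D, c, h1, h2⟩ := hP
      refine ⟨D + 1, c * ⟨α g * X j, hInt j⟩, ?_, ?_⟩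
      · change (c : MvPolynomial ρ ℂ) * (α g * X j) = _
        rw [h1]; ring
      · rw [map_mul, h2, map_mul, eval_X]
        have hy : χ₀ g * y j = χ ⟨α g * X j, hInt j⟩ := mul_div_cancel₀ _ hg
        rw [← hy]; ring
  refine ⟨y, fun p => ?_⟩
  obtain ⟨D, c, h1, h2⟩ := key (α p)
  have : c = algebraMap R C' (g ^ D * p) := by
    apply Subtype.ext
    rw [h1]
    change _ = α (g ^ D * p)
    simp
  rw [this, hχ, map_mul, map_pow] at h2
  exact (mul_left_cancel₀ (pow_ne_zero _ hg) h2).symm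

theorem generic_fiber {σ ρ : Type} [Fintype σ] [Fintype ρ] (δ : ℕ)
    (hcard : Fintype.card ρ = Fintype.card σ + δ)
    (φ : MvPolynomial σ ℂ →ₐ[ℂ] MvPolynomial ρ ℂ) (hφ : Function.Injective φ) :
    ∃ g : MvPolynomial σ ℂ, g ≠ 0 ∧ ∀ a : σ → ℂ, eval a g ≠ 0 →
      ringKrullDim (MvPolynomial ρ ℂ ⧸ Ideal.span (Set.range fun j => φ (X j) - C (a j))) = δ := by
  let B := MvPolynomial σ ℂ
  let A := MvPolynomial ρ ℂ
  let _ : Algebra B A := φ.toRingHom.toAlgebra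
  have : IsScalarTower ℂ B A := IsScalarTower.of_algebraMap_eq (fun c => (φ.commutes c).symm)
  have : FaithfulSMul B A := (faithfulSMul_iff_algebraMap_injective B A).mpr hφ
  have : Algebra.FiniteType B A := Algebra.FiniteType.of_restrictScalars_finiteType ℂ B A
  obtain ⟨r, t, ht, hInt⟩ := relNoether B A
  have hr : r = δ := by
    have halg : Algebra.IsAlgebraic (Algebra.adjoin B (Set.range t)) A := by
      refine ⟨fun x => ?_⟩
      obtain ⟨g, hg, hgx⟩ := hInt x
      have h1 : IsIntegral (Algebra.adjoin B (Set.range t)) (algebraMap B A g * x) := by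
        obtain ⟨p, hp, hpx⟩ := hgx
        refine ⟨p.map ((aeval (R := B) t).codRestrict _ (fun q => by
          rw [Algebra.adjoin_range_eq_range_aeval]; exact ⟨q, rfl⟩)).toRingHom, hp.map _, ?_⟩
        rw [Polynomial.eval₂_map]
        exact hpx
      refine IsAlgebraic.of_mul (y := algebraMap B A g) ?_ ?_ h1.isAlgebraic
      · rw [mem_nonZeroDivisors_iff_ne_zero]
        exact fun h => hg (hφ (h.trans (map_zero φ).symm))
      · rw [IsScalarTower.algebraMap_apply B (Algebra.adjoin B (Set.range t)) A]
        exact isAlgebraic_algebraMap _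
    have h1 : Algebra.trdeg ℂ B + Algebra.trdeg B A = Algebra.trdeg ℂ A := trdeg_add_eq ℂ B
    have h2 := (ht.isTranscendenceBasis_iff_isAlgebraic).mpr halg
    have h3 := h2.lift_cardinalMk_eq_trdeg
    simp only [Cardinal.mk_fintype, Fintype.card_fin, Cardinal.lift_natCast] at h3
    rw [Cardinal.lift_id] at h3
    have e1 : Algebra.trdeg ℂ B = (Fintype.card σ : Cardinal) := by
      simp [B, MvPolynomial.trdeg_of_isDomain]
    have e2 : Algebra.trdeg ℂ A = (Fintype.card ρ : Cardinal) := by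
      simp [A, MvPolynomial.trdeg_of_isDomain]
    rw [e1, e2, ← h3] at h1
    have h4 : Fintype.card σ + r = Fintype.card ρ := by exact_mod_cast h1
    omega
  subst hr
  choose g' hg' hg'x using fun j => hInt (X j)
  let g : B := ∏ j, g' j
  have hg0 : g ≠ 0 := Finset.prod_ne_zero_iff.mpr fun j _ => hg' j
  let α : MvPolynomial (Fin r) B →ₐ[ℂ] A := (aeval (R := B) t).restrictScalars ℂ
  have hαC : ∀ b, α (C b) = φ b := fun b => aeval_C t b
  have hgx : ∀ j, α.toRingHom.IsIntegralElem (α (C g) * X j) := by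
    classical
    intro j
    have : α (C g) * X j = α (C (∏ i ∈ Finset.univ.erase j, g' i)) * (φ (g' j) * X j) := by
      rw [← mul_assoc, hαC, hαC, ← map_mul]
      simp only [g]
      rw [Finset.prod_erase_mul _ _ (Finset.mem_univ j)]
    rw [this]
    exact RingHom.IsIntegralElem.mul _ (RingHom.isIntegralElem_map _) (hg'x j)
  refine ⟨g, hg0, fun a ha => ?_⟩
  set J := Ideal.span (Set.range fun j => φ (X j) - C (a j)) with hJ
  let E := A ⧸ J
  let π : A →ₐ[ℂ] E := Ideal.Quotient.mkₐ ℂ J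
  let β : MvPolynomial (Fin r) ℂ →ₐ[ℂ] E := aeval (fun i => π (t i))
  let ev : MvPolynomial (Fin r) B →ₐ[ℂ] MvPolynomial (Fin r) ℂ := MvPolynomial.mapAlgHom (aeval a)
  have haev : ∀ b : B, (aeval a : B →ₐ[ℂ] ℂ) b = eval a b := fun b => by rw [← coe_aeval_eq_eval]; rfl
  have hπφ : ∀ b : B, π (φ b) = algebraMap ℂ E (eval a b) := by
    intro b
    have : π.comp φ = (Algebra.ofId ℂ E).comp (aeval a) := by
      ext j
      simp only [AlgHom.comp_apply, aeval_X]
      have := (Ideal.Quotient.eq (I := J)).mpr (Ideal.subset_span ⟨j, rfl⟩)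
      exact this
    exact congrArg (fun f => f b) this
  have hsq : β.toRingHom.comp ev.toRingHom = π.toRingHom.comp α.toRingHom := by
    refine MvPolynomial.ringHom_ext ?_ ?_
    · intro b
      change β (ev (C b)) = π (α (C b))
      rw [hαC, hπφ]
      simp [ev, β, haev]
    · intro i
      simp [ev, β, α]
  have hEint : β.toRingHom.IsIntegral := by
    have hX : ∀ j, β.toRingHom.IsIntegralElem (π (X j)) := by
      intro j
      obtain ⟨p, hp, hpx⟩ := hgx j
      have h1 : β.toRingHom.IsIntegralElem (π (α (C g) * X j)) := by
        refine ⟨p.map ev.toRingHom, hp.map _, ?_⟩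
        rw [Polynomial.eval₂_map, hsq]
        have := congrArg π hpx
        rw [map_zero] at this
        rw [← this]
        exact (Polynomial.hom_eval₂ p α.toRingHom π.toRingHom _).symm
      rw [map_mul, hαC, hπφ] at h1
      have h2 : π (X j) = β (C (eval a g)⁻¹) * (algebraMap ℂ E (eval a g) * π (X j)) := by
        simp only [β, algHom_C]
        rw [← mul_assoc, ← map_mul, inv_mul_cancel₀ ha, map_one, one_mul]
      rw [h2]
      exact RingHom.IsIntegralElem.mul _ (RingHom.isIntegralElem_map _) h1
    intro x
    obtain ⟨P, rfl⟩ := Ideal.Quotient.mk_surjective x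
    change β.toRingHom.IsIntegralElem (π P)
    induction P using MvPolynomial.induction_on with
    | C c =>
      have : π (C c) = β (C c) := by
        exact (π.commutes c).trans (β.commutes c).symm
      rw [this]; exact RingHom.isIntegralElem_map _
    | add P Q hP hQ => rw [map_add]; exact RingHom.IsIntegralElem.add _ hP hQ
    | mul_X P j hP => rw [map_mul]; exact RingHom.IsIntegralElem.mul _ hP (hX j)
  have hinj : Function.Injective β := by
    rw [injective_iff_map_eq_zero]
    intro p hp
    refine MvPolynomial.funext fun t₀ => ?_
    obtain ⟨y, hy⟩ := lift_point α ht ((aeval t₀).comp ev) (C g) (by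
      simpa [ev, haev] using ha) hgx
    have hyJ : ∀ q ∈ J, eval y q = 0 := by
      intro q hq
      have : J ≤ RingHom.ker (eval y) := by
        rw [hJ, Ideal.span_le]
        rintro _ ⟨j, rfl⟩
        change eval y _ = 0
        have := hy (C (X j))
        rw [hαC] at this
        rw [map_sub, this]
        simp only [ev, AlgHom.comp_apply, mapAlgHom_apply, map_C, aeval_C, eval_C]
        simp [B]
      exact this hq
    -- lift p to B
    let p' : MvPolynomial (Fin r) B := MvPolynomial.map (algebraMap ℂ B) p
    have hp' : ev p' = p := by
      simp only [ev, p', mapAlgHom_apply]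
      rw [MvPolynomial.map_map]
      convert MvPolynomial.map_id p using 2
      ext c <;> simp [B]
    have h3 : π (α p') = 0 := by
      have := congrArg (fun f => f p') hsq
      change β (ev p') = π (α p') at this
      rw [← this, hp', hp]
    have h4 := hyJ _ (Ideal.Quotient.eq_zero_iff_mem.mp h3)
    rw [hy] at h4
    simpa [hp', aeval_eq_eval] using h4
  let _ : Algebra (MvPolynomial (Fin r) ℂ) E := β.toRingHom.toAlgebra
  have : Algebra.IsIntegral (MvPolynomial (Fin r) ℂ) E := ⟨hEint⟩
  have := ringKrullDim_integral_inj (R := MvPolynomial (Fin r) ℂ) (S := E) hinj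
  rw [this]
  simp

theorem dim_of_cover {X ι : Type} [TopologicalSpace X] (δ : ℕ) (U : ι → Set X)
    (i₀ : ι) (hU : ∀ i, IsOpen (U i)) (hcov : ∀ x, ∃ i, x ∈ U i)
    (hdim : ∀ i, topologicalKrullDim (U i) = (δ : WithBot ℕ∞)) :
    topologicalKrullDim X = (δ : WithBot ℕ∞) := by
  apply le_antisymm
  · unfold topologicalKrullDim
    rcases isEmpty_or_nonempty (TopologicalSpace.IrreducibleCloseds X) with h | h
    · rw [Order.krullDim_eq_bot]; exact bot_le
    rw [Order.krullDim_eq_iSup_coheight_of_nonempty]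
    have : ∀ V : TopologicalSpace.IrreducibleCloseds X, Order.coheight V ≤ (δ : ℕ∞) := by
      intro V
      obtain ⟨x, hx⟩ := V.isIrreducible.nonempty
      obtain ⟨i, hi⟩ := hcov x
      have hemb := (hU i).isOpenEmbedding_subtypeVal
      let V' : {V : TopologicalSpace.IrreducibleCloseds X | (((↑) : U i → X) ⁻¹' V).Nonempty} :=
        ⟨V, ⟨⟨x, hi⟩, hx⟩⟩
      let T := (TopologicalSpace.IrreducibleCloseds.orderIsoOfIsOpenEmbedding _ hemb).symm V'
      have hT : TopologicalSpace.IrreducibleCloseds.map _ hemb.continuous T = V :=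
        congrArg Subtype.val
          ((TopologicalSpace.IrreducibleCloseds.orderIsoOfIsOpenEmbedding _ hemb).apply_symm_apply V')
      rw [← hT, hemb.coheight_map]
      have h1 := Order.coheight_le_krullDim T
      have h2 := hdim i
      unfold topologicalKrullDim at h2
      rw [h2] at h1
      exact_mod_cast h1
    have := iSup_le this
    exact_mod_cast this
  · rw [← hdim i₀]
    exact topologicalKrullDim_subspace_le X (U i₀)

theorem dim_of_inducing_closedPoints {Z Y : Type} [TopologicalSpace Z] [TopologicalSpace Y]
    [JacobsonSpace Y] (f : Z → Y) (hf : Topology.IsInducing f)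
    (hr : Set.range f = closedPoints Y) :
    topologicalKrullDim Z = topologicalKrullDim Y := by
  apply le_antisymm hf.topologicalKrullDim_le
  have hcl : ∀ V : TopologicalSpace.IrreducibleCloseds Y,
      closure (Set.image f (Set.preimage f (V : Set Y))) = V := by
    intro V
    rw [Set.image_preimage_eq_inter_range, hr,
      JacobsonSpace.closure_inter_closedPoints V.isClosed]
  unfold topologicalKrullDim
  let g : TopologicalSpace.IrreducibleCloseds Y → TopologicalSpace.IrreducibleCloseds Z :=
    fun V => ⟨f ⁻¹' V, by
      have h : IsIrreducible (Set.image f (Set.preimage f (V : Set Y))) := by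
        rw [← isIrreducible_iff_closure, hcl V]; exact V.isIrreducible
      refine ⟨?_, ?_⟩
      · exact Set.image_nonempty.mp h.nonempty
      · intro A B hA hB hAs hBs
        obtain ⟨A', hA', rfl⟩ := hf.isOpen_iff.mp hA
        obtain ⟨B', hB', rfl⟩ := hf.isOpen_iff.mp hB
        obtain ⟨a, ha1, ha2⟩ := hAs
        obtain ⟨b, hb1, hb2⟩ := hBs
        obtain ⟨_, ⟨c, hc, rfl⟩, hc2⟩ := h.isPreirreducible A' B' hA' hB'
          ⟨f a, ⟨a, ha1, rfl⟩, ha2⟩ ⟨f b, ⟨b, hb1, rfl⟩, hb2⟩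
        exact ⟨c, hc, hc2⟩, V.isClosed.preimage hf.continuous⟩
  apply Order.krullDim_le_of_strictMono g
  intro V V' h
  refine lt_of_le_of_ne (Set.preimage_mono h.le : f ⁻¹' (V : Set Y) ⊆ f ⁻¹' V') ?_
  intro he
  have he' : f ⁻¹' (V : Set Y) = f ⁻¹' V' := congrArg (fun T : TopologicalSpace.IrreducibleCloseds Z => (T : Set Z)) he
  apply h.ne
  apply TopologicalSpace.IrreducibleCloseds.ext
  rw [← hcl V, ← hcl V', he']

theorem dim_of_chart {ρ : Type} [Fintype ρ] (J : Ideal (MvPolynomial ρ ℂ)) {Z : Type}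
    [TopologicalSpace Z] (pt : Z → (ρ → ℂ)) (h0 : Set.range pt = {y | ∀ p ∈ J, eval y p = 0})
    (h1 : ∀ H, IsOpen {z | eval (pt z) H ≠ 0})
    (h2 : ∀ (z : Z) (U : Set Z), z ∈ U → IsOpen U → ∃ H, eval (pt z) H ≠ 0 ∧
      ∀ z', eval (pt z') H ≠ 0 → z' ∈ U) :
    topologicalKrullDim Z = ringKrullDim (MvPolynomial ρ ℂ ⧸ J) := by
  rw [← PrimeSpectrum.topologicalKrullDim_eq_ringKrullDim]
  let E := MvPolynomial ρ ℂ ⧸ J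
  have hJ : ∀ z, ∀ p ∈ J, eval (pt z) p = 0 := by
    intro z
    have : pt z ∈ Set.range pt := ⟨z, rfl⟩
    rwa [h0] at this
  let χ : Z → E →+* ℂ := fun z => Ideal.Quotient.lift J (eval (pt z)) (hJ z)
  have hχ : ∀ z, ∀ p, χ z (Ideal.Quotient.mk J p) = eval (pt z) p := fun z p => rfl
  have hsurj : ∀ z, Function.Surjective (χ z) := fun z c => ⟨Ideal.Quotient.mk J (C c), by
    rw [hχ]; simp⟩
  let f : Z → PrimeSpectrum E := fun z => ⟨RingHom.ker (χ z), RingHom.ker_isPrime _⟩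
  have hmax : ∀ z, (RingHom.ker (χ z)).IsMaximal := fun z =>
    RingHom.ker_isMaximal_of_surjective _ (hsurj z)
  apply dim_of_inducing_closedPoints f
  · constructor
    apply le_antisymm
    · rw [← continuous_iff_le_induced]
      apply PrimeSpectrum.isTopologicalBasis_basic_opens.continuous_iff.mpr
      rintro _ ⟨q, rfl⟩
      obtain ⟨H, rfl⟩ := Ideal.Quotient.mk_surjective q
      exact h1 H
    · intro U hU
      apply (@isOpen_iff_forall_mem_open _ (TopologicalSpace.induced f _) U).mpr
      intro z hz
      obtain ⟨H, hH, hHU⟩ := h2 z U hz hU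
      refine ⟨{z | eval (pt z) H ≠ 0}, fun z' hz' => hHU z' hz', ?_, hH⟩
      exact isOpen_induced_iff.mpr ⟨_, (PrimeSpectrum.basicOpen (Ideal.Quotient.mk J H)).isOpen, rfl⟩
  · ext P
    rw [mem_closedPoints_iff, PrimeSpectrum.isClosed_singleton_iff_isMaximal]
    constructor
    · rintro ⟨z, rfl⟩
      exact hmax z
    · intro hP
      have hP' : (P.asIdeal.comap (Ideal.Quotient.mk J)).IsMaximal :=
        Ideal.comap_isMaximal_of_surjective _ Ideal.Quotient.mk_surjective
      obtain ⟨y, hy⟩ := MvPolynomial.isMaximal_iff_eq_vanishingIdeal_singleton.mp hP'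
      have hmem : ∀ p, Ideal.Quotient.mk J p ∈ P.asIdeal ↔ eval y p = 0 := by
        intro p
        rw [← Ideal.mem_comap, hy, MvPolynomial.mem_vanishingIdeal_singleton_iff]
        rfl
      have hy0 : y ∈ Set.range pt := by
        rw [h0]
        intro p hp
        rw [← hmem, Ideal.Quotient.eq_zero_iff_mem.mpr hp]
        exact zero_mem _
      obtain ⟨z, rfl⟩ := hy0
      refine ⟨z, ?_⟩
      ext q
      obtain ⟨p, rfl⟩ := Ideal.Quotient.mk_surjective q
      rw [hmem]
      exact RingHom.mem_ker

/-- monomials of degree `d` in the variables `Fin 2 ⊕ Fin N` not supported on `Fin 2`. -/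
def Tt (N d : ℕ) : Type :=
  {m : (Fin 2 ⊕ Fin N) →₀ ℕ // m.degree = d ∧ ∃ k, m (Sum.inr k) ≠ 0}

instance instFiniteTt (N d : ℕ) : Finite (Tt N d) := by
  have h : {m : (Fin 2 ⊕ Fin N) →₀ ℕ | m.degree ≤ d}.Finite := Finsupp.finite_of_degree_le d
  have : Finite {m : (Fin 2 ⊕ Fin N) →₀ ℕ | m.degree ≤ d} := h
  exact Finite.of_injective
    (fun t : Tt N d => (⟨t.1, t.2.1.le⟩ : {m : (Fin 2 ⊕ Fin N) →₀ ℕ | m.degree ≤ d}))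
    (fun _ _ h => Subtype.ext (Subtype.mk.inj h))

instance instFintypeTt (N d : ℕ) : Fintype (Tt N d) := Fintype.ofFinite _

/-- all monomials of degree `d`. -/
def mon {N d : ℕ} : Tt N d ⊕ Fin (d + 1) → ((Fin 2 ⊕ Fin N) →₀ ℕ)
  | Sum.inl t => t.1
  | Sum.inr j => Finsupp.single (Sum.inl 0) j.1 + Finsupp.single (Sum.inl 1) (d - j.1)

theorem mon_degree {N d : ℕ} (x : Tt N d ⊕ Fin (d + 1)) : (mon x).degree = d := by
  rcases x with t | j
  · exact t.2.1
  · simp only [mon, map_add, Finsupp.degree_single]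
    omega

theorem mon_inr_apply {N d : ℕ} (j : Fin (d + 1)) (k : Fin N) :
    mon (Sum.inr j : Tt N d ⊕ Fin (d + 1)) (Sum.inr k) = 0 := by
  simp [mon]

theorem mon_inr_zero {N d : ℕ} (j : Fin (d + 1)) :
    mon (Sum.inr j : Tt N d ⊕ Fin (d + 1)) (Sum.inl 0) = j.1 := by
  simp [mon]

theorem mon_inr_one {N d : ℕ} (j : Fin (d + 1)) :
    mon (Sum.inr j : Tt N d ⊕ Fin (d + 1)) (Sum.inl 1) = d - j.1 := by
  simp [mon]

theorem mon_injective {N d : ℕ} : Function.Injective (mon : Tt N d ⊕ Fin (d + 1) → _) := by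
  rintro (t | j) (t' | j') h
  · exact congrArg _ (Subtype.ext h)
  · obtain ⟨k, hk⟩ := t.2.2
    have := DFunLike.congr_fun h (Sum.inr k)
    rw [mon_inr_apply] at this
    exact absurd this hk
  · obtain ⟨k, hk⟩ := t'.2.2
    have := DFunLike.congr_fun h (Sum.inr k)
    rw [mon_inr_apply] at this
    exact absurd this.symm hk
  · have := DFunLike.congr_fun h (Sum.inl 0)
    rw [mon_inr_zero, mon_inr_zero] at this
    exact congrArg _ (Fin.ext this)

theorem degree_eq {N : ℕ} (m : (Fin 2 ⊕ Fin N) →₀ ℕ) :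
    m.degree = m (Sum.inl 0) + m (Sum.inl 1) + ∑ k, m (Sum.inr k) := by
  rw [Finsupp.degree_eq_sum]
  simp

theorem mon_surj {N d : ℕ} (m : (Fin 2 ⊕ Fin N) →₀ ℕ) (hm : m.degree = d) :
    ∃ x : Tt N d ⊕ Fin (d + 1), mon x = m := by
  by_cases h : ∃ k, m (Sum.inr k) ≠ 0
  · exact ⟨Sum.inl ⟨m, hm, h⟩, rfl⟩
  · push Not at h
    have h2 := degree_eq m
    simp only [h, Finset.sum_const_zero] at h2
    refine ⟨Sum.inr ⟨m (Sum.inl 0), by omega⟩, ?_⟩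
    ext x
    rcases x with a | k
    · fin_cases a
      · exact mon_inr_zero _
      · refine (mon_inr_one _).trans ?_
        show d - m (Sum.inl 0) = m (Sum.inl 1)
        omega
    · rw [mon_inr_apply, h]

/-- the form with given coefficients. -/
def hp {R : Type} [CommRing R] {N d : ℕ} (c : Tt N d → R) : MvPolynomial (Fin 2 ⊕ Fin N) R :=
  ∑ t, monomial t.1 (c t)

def shearVar {R : Type} [CommRing R] {N : ℕ} (M : Fin 2 × Fin N → R) :
    Fin 2 ⊕ Fin N → MvPolynomial (Fin 2 ⊕ Fin N) R :=
  Sum.elim (fun a => X (Sum.inl a))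
    (fun k => X (Sum.inr k) + (C (M (0, k)) * X (Sum.inl 0) + C (M (1, k)) * X (Sum.inl 1)))

/-- the shear substitution. -/
def shear {R : Type} [CommRing R] {N : ℕ} (M : Fin 2 × Fin N → R) :
    MvPolynomial (Fin 2 ⊕ Fin N) R →ₐ[R] MvPolynomial (Fin 2 ⊕ Fin N) R :=
  aeval (shearVar M)

theorem shear_shear {R : Type} [CommRing R] {N : ℕ} (M M' : Fin 2 × Fin N → R) (h : M + M' = 0)
    (p : MvPolynomial (Fin 2 ⊕ Fin N) R) : shear M (shear M' p) = p := by
  have : (shear M).comp (shear M') = AlgHom.id R _ := by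
    apply MvPolynomial.algHom_ext
    rintro (a | k)
    · simp [shear, shearVar]
    · have h0 : M (0, k) + M' (0, k) = 0 := congrFun h _
      have h1 : M (1, k) + M' (1, k) = 0 := congrFun h _
      rw [add_eq_zero_iff_eq_neg] at h0 h1
      simp [shear, shearVar, h0, h1]
      ring
  exact DFunLike.congr_fun this p

theorem map_shear {R S : Type} [CommRing R] [CommRing S] (f : R →+* S) {N : ℕ}
    (M : Fin 2 × Fin N → R) (p : MvPolynomial (Fin 2 ⊕ Fin N) R) :
    map f (shear M p) = shear (fun x => f (M x)) (map f p) := by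
  induction p using MvPolynomial.induction_on with
  | C a => simp [shear]
  | add p q hp hq => simp [hp, hq]
  | mul_X p i hp =>
    rw [map_mul, map_mul, hp, map_mul, map_mul, map_X]
    congr 1
    rcases i with a | k <;> simp [shear, shearVar]

theorem map_hp {R S : Type} [CommRing R] [CommRing S] (f : R →+* S) {N d : ℕ} (c : Tt N d → R) :
    map f (hp c) = hp (fun t => f (c t)) := by
  simp [hp, map_monomial]

theorem isHomogeneous_hp {R : Type} [CommRing R] {N d : ℕ} (c : Tt N d → R) :
    (hp c).IsHomogeneous d := by
  apply IsHomogeneous.sum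
  intro t _
  exact isHomogeneous_monomial _ t.2.1

theorem isHomogeneous_shear {R : Type} [CommRing R] {N d : ℕ} (M : Fin 2 × Fin N → R)
    (p : MvPolynomial (Fin 2 ⊕ Fin N) R) (hp : p.IsHomogeneous d) :
    (shear M p).IsHomogeneous d := by
  have : ∀ x, (shearVar M x).IsHomogeneous 1 := by
    rintro (a | k)
    · exact isHomogeneous_X _ _
    · refine (isHomogeneous_X _ _).add (IsHomogeneous.add ?_ ?_)
      · simpa using (isHomogeneous_C (Fin 2 ⊕ Fin N) (M (0, k))).mul (isHomogeneous_X R (Sum.inl 0))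
      · simpa using (isHomogeneous_C (Fin 2 ⊕ Fin N) (M (1, k))).mul (isHomogeneous_X R (Sum.inl 1))
  have h := hp.aeval (shearVar M) (n := 1) this
  rwa [one_mul] at h

theorem coeff_hp_inl {R : Type} [CommRing R] {N d : ℕ} (c : Tt N d → R) (t : Tt N d) :
    coeff t.1 (hp c) = c t := by
  classical
  rw [hp, coeff_sum, Finset.sum_eq_single t]
  · simp
  · intro b _ hb
    rw [coeff_monomial, if_neg (fun h => hb (Subtype.ext h))]
  · simp

theorem coeff_hp_inr {R : Type} [CommRing R] {N d : ℕ} (c : Tt N d → R) (j : Fin (d + 1)) :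
    coeff (mon (Sum.inr j : Tt N d ⊕ Fin (d + 1))) (hp c) = 0 := by
  classical
  rw [hp, coeff_sum]
  apply Finset.sum_eq_zero
  intro t _
  rw [coeff_monomial, if_neg]
  intro h
  have := mon_injective (N := N) (d := d) (a₁ := Sum.inl t) (a₂ := Sum.inr j) h
  simp at this

theorem eq_of_coeff_mon {R : Type} [CommRing R] {N d : ℕ} (p q : MvPolynomial (Fin 2 ⊕ Fin N) R)
    (hp : p.IsHomogeneous d) (hq : q.IsHomogeneous d)
    (h : ∀ x : Tt N d ⊕ Fin (d + 1), coeff (mon x) p = coeff (mon x) q) : p = q := by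
  ext m
  by_cases hm : m.degree = d
  · obtain ⟨x, rfl⟩ := mon_surj m hm
    exact h x
  · rw [hp.coeff_eq_zero hm, hq.coeff_eq_zero hm]

theorem eq_hp {R : Type} [CommRing R] {N d : ℕ} (p : MvPolynomial (Fin 2 ⊕ Fin N) R)
    (hp' : p.IsHomogeneous d)
    (h : ∀ j : Fin (d + 1), coeff (mon (Sum.inr j : Tt N d ⊕ Fin (d + 1))) p = 0) :
    hp (fun t : Tt N d => coeff t.1 p) = p := by
  apply eq_of_coeff_mon _ _ (isHomogeneous_hp _) hp'
  rintro (t | j)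
  · exact coeff_hp_inl _ t
  · rw [coeff_hp_inr, h]

abbrev Ss (N : ℕ) {s : ℕ} (d : Fin s → ℕ) : Type := Σ i : Fin s, Tt N (d i) ⊕ Fin (d i + 1)

abbrev Rr (N : ℕ) {s : ℕ} (d : Fin s → ℕ) : Type := (Σ i : Fin s, Tt N (d i)) ⊕ (Fin 2 × Fin N)

theorem card_Rr (N : ℕ) {s : ℕ} (d : Fin s → ℕ) (δ : ℕ) (h : ∑ i, d i + s + δ = 2 * N) :
    Fintype.card (Rr N d) = Fintype.card (Ss N d) + δ := by
  simp only [Rr, Ss, Fintype.card_sum, Fintype.card_sigma, Fintype.card_prod, Fintype.card_fin,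
    Finset.sum_add_distrib, Finset.sum_const, Finset.card_univ, smul_eq_mul]
  omega

def phiPt {R : Type} [CommRing R] {N s : ℕ} {d : Fin s → ℕ} (c : (Σ i : Fin s, Tt N (d i)) → R)
    (M : Fin 2 × Fin N → R) (x : Ss N d) : R :=
  coeff (mon x.2) (shear (-M) (hp fun t => c ⟨x.1, t⟩))

def phi (N : ℕ) {s : ℕ} (d : Fin s → ℕ) :
    MvPolynomial (Ss N d) ℂ →ₐ[ℂ] MvPolynomial (Rr N d) ℂ :=
  aeval (phiPt (fun t => X (Sum.inl t)) (fun t => X (Sum.inr t)))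

theorem eval_phi_X {N s : ℕ} {d : Fin s → ℕ} (y : Rr N d → ℂ) (x : Ss N d) :
    eval y (phi N d (X x)) = phiPt (fun t => y (Sum.inl t)) (fun t => y (Sum.inr t)) x := by
  rw [phi, aeval_X, phiPt, phiPt, ← coeff_map, map_shear, map_hp]
  simp [Pi.neg_def]

theorem phiPt_eq_iff {N s : ℕ} {d : Fin s → ℕ} (f : Fin s → MvPolynomial (Fin 2 ⊕ Fin N) ℂ)
    (hf : ∀ i, (f i).IsHomogeneous (d i)) (c : (Σ i : Fin s, Tt N (d i)) → ℂ)
    (M : Fin 2 × Fin N → ℂ) :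
    (∀ x : Ss N d, phiPt c M x = coeff (mon x.2) (f x.1)) ↔
      ∀ i, hp (fun t => c ⟨i, t⟩) = shear M (f i) := by
  constructor
  · intro h i
    have : shear (-M) (hp fun t => c ⟨i, t⟩) = f i :=
      eq_of_coeff_mon _ _ (isHomogeneous_shear _ _ (isHomogeneous_hp _)) (hf i)
        (fun x => h ⟨i, x⟩)
    rw [← this, shear_shear _ _ (by simp)]
  · intro h x
    rw [phiPt, h, shear_shear _ _ (by simp)]

def off {s : ℕ} (d : Fin s → ℕ) (i : Fin s) : ℕ := ∑ i' with i' < i, (d i' + 1)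

theorem off_lt {s : ℕ} (d : Fin s → ℕ) {i i' : Fin s} (h : i < i') :
    off d i + d i + 1 ≤ off d i' := by
  classical
  have h1 : off d i + (d i + 1) = ∑ j ∈ insert i (Finset.univ.filter (· < i)), (d j + 1) := by
    rw [Finset.sum_insert (by simp), add_comm]; rfl
  rw [add_assoc, h1]
  apply Finset.sum_le_sum_of_subset
  intro j hj
  simp only [Finset.mem_insert, Finset.mem_filter, Finset.mem_univ, true_and] at hj ⊢
  rcases hj with rfl | hj
  · exact h
  · exact hj.trans h

theorem off_le {s : ℕ} (d : Fin s → ℕ) (i : Fin s) :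
    off d i + d i + 1 ≤ ∑ j, d j + s := by
  classical
  have h1 : off d i + (d i + 1) = ∑ j ∈ insert i (Finset.univ.filter (· < i)), (d j + 1) := by
    rw [Finset.sum_insert (by simp), add_comm]; rfl
  rw [add_assoc, h1]
  have : ∑ j, d j + s = ∑ j, (d j + 1) := by simp [Finset.sum_add_distrib]
  rw [this]
  exact Finset.sum_le_sum_of_subset (Finset.subset_univ _)

def Gp (o d k j : ℕ) : Prop :=
  j < d ∧ (o + j = 2 * k ∨ (2 * k = o + d ∧ j + 1 = d) ∨ (2 * k + 1 = o ∧ j = 0))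

open Classical in
theorem span_all {s N : ℕ} (d : Fin s → ℕ) (hd : ∀ i, 2 ≤ d i) (hN : ∑ i, d i + s ≤ 2 * N)
    (S : Submodule ℂ ((Σ i : Fin s, Fin (d i + 1)) → ℂ))
    (h1 : ∀ k : Fin N, (fun x => if Gp (off d x.1) (d x.1) k x.2 then (1 : ℂ) else 0) ∈ S)
    (h0 : ∀ k : Fin N, (fun x => if 1 ≤ x.2.1 ∧ Gp (off d x.1) (d x.1) k (x.2 - 1) then (1 : ℂ)
      else 0) ∈ S) : S = ⊤ := by
  have htri : ∀ i i' : Fin s, i = i' ∨ off d i + d i + 1 ≤ off d i' ∨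
      off d i' + d i' + 1 ≤ off d i := by
    intro i i'
    rcases lt_trichotomy i i' with h | h | h
    · exact Or.inr (Or.inl (off_lt d h))
    · exact Or.inl h
    · exact Or.inr (Or.inr (off_lt d h))
  have hk : ∀ i (j : Fin (d i + 1)), (off d i + j) / 2 < N := by
    intro i j
    have := off_le d i
    omega
  -- even, not last
  have A1 : ∀ i (j : Fin (d i + 1)), j.1 < d i → (off d i + j) % 2 = 0 →
      Pi.single (⟨i, j⟩ : Σ i : Fin s, Fin (d i + 1)) (1 : ℂ) ∈ S := by
    intro i j hj he
    convert h1 ⟨_, hk i j⟩ using 1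
    funext ⟨i', j'⟩
    rw [Pi.single_apply]
    congr 1
    apply propext
    simp only [Gp]
    have := hd i'
    constructor
    · intro h
      cases h
      omega
    · intro h
      rcases htri i i' with rfl | h' | h'
      · have : j' = j := Fin.ext (by omega)
        rw [this]
      · omega
      · omega
  have A2 : ∀ i (j : Fin (d i + 1)), 1 ≤ j.1 → (off d i + j) % 2 = 1 →
      Pi.single (⟨i, j⟩ : Σ i : Fin s, Fin (d i + 1)) (1 : ℂ) ∈ S := by
    intro i j hj he
    convert h0 ⟨_, hk i j⟩ using 1
    funext ⟨i', j'⟩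
    rw [Pi.single_apply]
    congr 1
    apply propext
    simp only [Gp]
    have := hd i'
    constructor
    · intro h
      cases h
      omega
    · intro h
      rcases htri i i' with rfl | h' | h'
      · have : j' = j := Fin.ext (by omega)
        rw [this]
      · omega
      · omega
  have A3 : ∀ i (j : Fin (d i + 1)), j.1 = d i → (off d i + j) % 2 = 0 →
      Pi.single (⟨i, j⟩ : Σ i : Fin s, Fin (d i + 1)) (1 : ℂ) ∈ S := by
    intro i j hj he
    by_cases hex : ∃ i', off d i' = off d i + d i + 1
    · obtain ⟨i', hi'⟩ := hex
      have h2 := hd i'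
      have hS := A1 i' ⟨1, by omega⟩ (by simp only; omega) (by simp only; omega)
      have hS2 := S.sub_mem (h0 ⟨_, hk i j⟩) hS
      convert hS2 using 1
      funext ⟨i₂, j₂⟩
      have h3 := hd i₂
      have h4 := hd i
      rw [Pi.sub_apply, Pi.single_apply, Pi.single_apply]
      by_cases e1 : (⟨i₂, j₂⟩ : Σ i : Fin s, Fin (d i + 1)) = ⟨i, j⟩
      · have e2 : ¬ (⟨i₂, j₂⟩ : Σ i : Fin s, Fin (d i + 1)) = ⟨i', ⟨1, by omega⟩⟩ := by
          rw [e1]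
          intro h
          have : i = i' := congrArg Sigma.fst h
          subst this
          omega
        rw [if_pos e1, if_neg e2, if_pos, sub_zero]
        cases e1
        simp only [Gp]
        omega
      · rw [if_neg e1]
        by_cases e2 : (⟨i₂, j₂⟩ : Σ i : Fin s, Fin (d i + 1)) = ⟨i', ⟨1, by omega⟩⟩
        · rw [if_pos e2, if_pos, sub_self]
          cases e2
          simp only [Gp]
          refine ⟨le_refl _, ?_, Or.inr (Or.inr ⟨?_, trivial⟩)⟩
          · show 0 < d i'
            omega
          · show 2 * ((off d i + j) / 2) + 1 = off d i'
            omega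
        · rw [if_neg e2, if_neg, sub_self]
          simp only [Gp]
          intro h
          rcases htri i i₂ with rfl | h' | h'
          · have : j₂ = j := Fin.ext (by omega)
            rw [this] at e1
            exact e1 rfl
          · rcases htri i' i₂ with rfl | h'' | h''
            · have : j₂ = ⟨1, by omega⟩ := Fin.ext (by simp only; omega)
              rw [this] at e2
              exact e2 rfl
            · omega
            · omega
          · omega
    · push Not at hex
      convert h0 ⟨_, hk i j⟩ using 1
      funext ⟨i', j'⟩
      rw [Pi.single_apply]
      congr 1
      apply propext
      simp only [Gp]
      have h2 := hd i'
      have h3 := hex i'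
      constructor
      · intro h
        cases h
        omega
      · intro h
        rcases htri i i' with rfl | h' | h'
        · have : j' = j := Fin.ext (by omega)
          rw [this]
        · omega
        · omega
  have A4 : ∀ i (j : Fin (d i + 1)), j.1 = 0 → (off d i + j) % 2 = 1 →
      Pi.single (⟨i, j⟩ : Σ i : Fin s, Fin (d i + 1)) (1 : ℂ) ∈ S := by
    intro i j hj he
    by_cases hex : ∃ i', off d i' + d i' + 1 = off d i
    · obtain ⟨i', hi'⟩ := hex
      have h2 := hd i'
      have hS := A2 i' ⟨d i' - 1, by omega⟩ (by simp only; omega) (by simp only; omega)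
      have hS2 := S.sub_mem (h1 ⟨_, hk i j⟩) hS
      convert hS2 using 1
      funext ⟨i₂, j₂⟩
      have h3 := hd i₂
      have h4 := hd i
      rw [Pi.sub_apply, Pi.single_apply, Pi.single_apply]
      by_cases e1 : (⟨i₂, j₂⟩ : Σ i : Fin s, Fin (d i + 1)) = ⟨i, j⟩
      · have e2 : ¬ (⟨i₂, j₂⟩ : Σ i : Fin s, Fin (d i + 1)) = ⟨i', ⟨d i' - 1, by omega⟩⟩ := by
          rw [e1]
          intro h
          have : i = i' := congrArg Sigma.fst h
          subst this
          omega
        rw [if_pos e1, if_neg e2, if_pos, sub_zero]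
        cases e1
        simp only [Gp]
        omega
      · rw [if_neg e1]
        by_cases e2 : (⟨i₂, j₂⟩ : Σ i : Fin s, Fin (d i + 1)) = ⟨i', ⟨d i' - 1, by omega⟩⟩
        · rw [if_pos e2, if_pos, sub_self]
          cases e2
          simp only [Gp]
          omega
        · rw [if_neg e2, if_neg, sub_self]
          simp only [Gp]
          intro h
          rcases htri i i₂ with rfl | h' | h'
          · have : j₂ = j := Fin.ext (by omega)
            rw [this] at e1
            exact e1 rfl
          · omega
          · rcases htri i' i₂ with rfl | h'' | h''
            · have : j₂ = ⟨d i' - 1, by omega⟩ := Fin.ext (by simp only; omega)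
              rw [this] at e2
              exact e2 rfl
            · omega
            · omega
    · push Not at hex
      convert h1 ⟨_, hk i j⟩ using 1
      funext ⟨i', j'⟩
      rw [Pi.single_apply]
      congr 1
      apply propext
      simp only [Gp]
      have h2 := hd i'
      have h3 := hex i'
      constructor
      · intro h
        cases h
        omega
      · intro h
        rcases htri i i' with rfl | h' | h'
        · have : j' = j := Fin.ext (by omega)
          rw [this]
        · omega
        · omega
  have A : ∀ x, Pi.single (x : Σ i : Fin s, Fin (d i + 1)) (1 : ℂ) ∈ S := by
    rintro ⟨i, j⟩
    rcases Nat.mod_two_eq_zero_or_one (off d i + j) with h | h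
    · by_cases hj : j.1 < d i
      · exact A1 i j hj h
      · exact A3 i j (by omega) h
    · by_cases hj : 1 ≤ j.1
      · exact A2 i j hj h
      · exact A4 i j (by omega) h
  rw [eq_top_iff]
  intro w _
  rw [← Finset.univ_sum_single w]
  apply S.sum_mem
  intro x _
  have : Pi.single x (w x) = w x • (Pi.single x (1 : ℂ) : (Σ i : Fin s, Fin (d i + 1)) → ℂ) := by
    rw [← Pi.single_smul]; simp
  rw [this]
  exact S.smul_mem _ (A x)

theorem injective_of_directions {σ ρ : Type} [Fintype σ] [Fintype ρ]
    (φ : MvPolynomial σ ℂ →ₐ[ℂ] MvPolynomial ρ ℂ) (y₀ : ρ → ℂ)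
    (h : ∀ S : Submodule ℂ (σ → ℂ), (∀ (v : σ → ℂ) (w : ρ → ℂ),
      (∀ (τ : ℂ) (j : σ), eval (y₀ + τ • w) (φ (X j)) = eval y₀ (φ (X j)) + τ * v j) → v ∈ S) →
      S = ⊤) : Function.Injective φ := by
  let Φ : (ρ → ℂ) → (σ → ℂ) := fun y j => eval y (φ (X j))
  have hΦ : ContDiff ℂ 1 Φ := by
    rw [contDiff_pi]
    intro j
    have h1 : AnalyticOnNhd ℂ (fun y : ρ → ℂ => aeval y (φ (X j))) Set.univ :=
      AnalyticOnNhd.aeval_mvPolynomial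
        (fun i y _ => (ContinuousLinearMap.proj (R := ℂ) (φ := fun _ : ρ => ℂ) i).analyticAt y)
        (φ (X j))
    have h2 := h1.contDiff (n := 1)
    simpa [aeval_eq_eval, Φ] using h2
  have hs : HasStrictFDerivAt Φ (fderiv ℂ Φ y₀) y₀ :=
    hΦ.contDiffAt.hasStrictFDerivAt (by norm_num)
  have hrange : (fderiv ℂ Φ y₀).range = ⊤ := by
    apply h
    intro v w hvw
    refine ⟨w, ?_⟩
    have hl := (hs.hasFDerivAt.hasLineDerivAt w)
    unfold HasLineDerivAt at hl
    have he : (fun t : ℂ => Φ (y₀ + t • w)) = fun t => Φ y₀ + t • v := by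
      funext t j
      exact hvw t j
    rw [he] at hl
    have hl2 : HasDerivAt (fun t : ℂ => Φ y₀ + t • v) v 0 := by
      simpa using ((hasDerivAt_id (0 : ℂ)).smul_const v).const_add (Φ y₀)
    exact hl.unique hl2
  have hnhds := hs.map_nhds_eq_of_surj hrange
  have himg : Set.range Φ ∈ nhds (Φ y₀) := by
    rw [← hnhds, Filter.mem_map]
    simp
  rw [injective_iff_map_eq_zero]
  intro P hP
  have hcomp : ∀ y, eval (Φ y) P = 0 := by
    intro y
    have h1 : ((aeval y).comp φ : MvPolynomial σ ℂ →ₐ[ℂ] ℂ) = aeval (Φ y) := by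
      apply MvPolynomial.algHom_ext
      intro j
      simp [Φ, aeval_eq_eval]
    have h2 := DFunLike.congr_fun h1 P
    rw [AlgHom.comp_apply, hP, map_zero, aeval_eq_eval] at h2
    exact h2.symm
  obtain ⟨ε, hε, hball⟩ := Metric.mem_nhds_iff.mp himg
  apply MvPolynomial.funext_set (fun j => Metric.ball (Φ y₀ j) ε)
  · intro j
    apply infinite_of_mem_nhds (Φ y₀ j)
    exact Metric.ball_mem_nhds _ hε
  · intro x hx
    have : x ∈ Metric.ball (Φ y₀) ε := by
      rw [ball_pi _ hε]
      exact hx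
    obtain ⟨y, rfl⟩ := hball this
    rw [hcomp, map_zero]

open Classical in
/-- the binary form `g_{ik}` -/
def qq (N o d k : ℕ) : MvPolynomial (Fin 2 ⊕ Fin N) ℂ :=
  ∑ j : Fin d, if Gp o d k j then
    X (Sum.inl 0) ^ j.1 * X (Sum.inl 1) ^ (d - 1 - j.1) else 0

theorem shear_qq (N o d k : ℕ) (M : Fin 2 × Fin N → ℂ) : shear M (qq N o d k) = qq N o d k := by
  rw [qq, map_sum]
  apply Finset.sum_congr rfl
  intro j _
  split_ifs
  · simp [shear, shearVar]
  · simp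

theorem monomial_mon_inr {N d : ℕ} (j : Fin (d + 1)) :
    (monomial (mon (Sum.inr j : Tt N d ⊕ Fin (d + 1))) (1 : ℂ)) =
      X (Sum.inl 0) ^ j.1 * X (Sum.inl 1) ^ (d - j.1) := by
  rw [mon, ← one_mul (1 : ℂ), ← monomial_mul, X_pow_eq_monomial, X_pow_eq_monomial]

open Classical in
theorem X0_mul_qq (N o d k : ℕ) : X (Sum.inl 0) * qq N o d k =
    ∑ j : Fin d, if Gp o d k j then
      (monomial (mon (Sum.inr j.succ : Tt N d ⊕ Fin (d + 1))) (1 : ℂ)) else 0 := by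
  rw [qq, Finset.mul_sum]
  apply Finset.sum_congr rfl
  intro j _
  split_ifs
  · rw [monomial_mon_inr, Fin.val_succ, pow_succ, show d - 1 - j.1 = d - (j.1 + 1) by omega]
    ring
  · simp

open Classical in
theorem X1_mul_qq (N o d k : ℕ) : X (Sum.inl 1) * qq N o d k =
    ∑ j : Fin d, if Gp o d k j then
      (monomial (mon (Sum.inr j.castSucc : Tt N d ⊕ Fin (d + 1))) (1 : ℂ)) else 0 := by
  rw [qq, Finset.mul_sum]
  apply Finset.sum_congr rfl
  intro j _
  split_ifs
  · rw [monomial_mon_inr, Fin.val_castSucc, show d - j.1 = (d - 1 - j.1) + 1 by omega, pow_succ]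
    ring
  · simp

open Classical in
theorem coeff_sum_mon {N d : ℕ} (G : Fin d → Prop) (r : Fin d → Fin (d + 1))
    (x : Tt N d ⊕ Fin (d + 1)) :
    coeff (mon x) (∑ j : Fin d, if G j then
      (monomial (mon (Sum.inr (r j) : Tt N d ⊕ Fin (d + 1))) (1 : ℂ)) else 0) =
    ∑ j : Fin d, if G j ∧ Sum.inr (r j) = x then 1 else 0 := by
  rw [coeff_sum]
  apply Finset.sum_congr rfl
  intro j _
  by_cases hG : G j
  · rw [if_pos hG, coeff_monomial]
    simp [hG, mon_injective.eq_iff]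
  · simp [hG]

open Classical in
theorem coeff_X0_qq (N o d k : ℕ) (x : Tt N d ⊕ Fin (d + 1)) :
    coeff (mon x) (X (Sum.inl 0) * qq N o d k) =
      Sum.elim (fun _ => 0) (fun j : Fin (d + 1) => if 1 ≤ j.1 ∧ Gp o d k (j - 1) then (1 : ℂ) else 0) x := by
  rw [X0_mul_qq, coeff_sum_mon (fun j => Gp o d k j)]
  rcases x with t | j
  · simp
  · rw [Sum.elim_inr]
    split_ifs with h
    · have hj : j.1 - 1 < d := h.2.1
      rw [Finset.sum_eq_single ⟨j.1 - 1, hj⟩]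
      · rw [if_pos]
        refine ⟨h.2, ?_⟩
        congr 1
        apply Fin.ext
        simp only [Fin.val_succ]
        omega
      · intro b _ hb
        rw [if_neg]
        rintro ⟨_, h2⟩
        apply hb
        apply Fin.ext
        have := congrArg Fin.val (Sum.inr_injective h2)
        simp only [Fin.val_succ] at this
        simp only
        omega
      · simp
    · apply Finset.sum_eq_zero
      intro b _
      rw [if_neg]
      rintro ⟨h1, h2⟩
      apply h
      have := congrArg Fin.val (Sum.inr_injective h2)
      simp only [Fin.val_succ] at this
      refine ⟨by omega, ?_⟩
      rw [← this]
      exact h1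

open Classical in
theorem coeff_X1_qq (N o d k : ℕ) (x : Tt N d ⊕ Fin (d + 1)) :
    coeff (mon x) (X (Sum.inl 1) * qq N o d k) =
      Sum.elim (fun _ => 0) (fun j : Fin (d + 1) => if Gp o d k j then (1 : ℂ) else 0) x := by
  rw [X1_mul_qq, coeff_sum_mon (fun j => Gp o d k j)]
  rcases x with t | j
  · simp
  · rw [Sum.elim_inr]
    split_ifs with h
    · have hj : j.1 < d := h.1
      rw [Finset.sum_eq_single ⟨j.1, hj⟩]
      · rw [if_pos]
        exact ⟨h, rfl⟩
      · intro b _ hb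
        rw [if_neg]
        rintro ⟨_, h2⟩
        apply hb
        apply Fin.ext
        have := congrArg Fin.val (Sum.inr_injective h2)
        exact this
      · simp
    · apply Finset.sum_eq_zero
      intro b _
      rw [if_neg]
      rintro ⟨h1, h2⟩
      apply h
      have := congrArg Fin.val (Sum.inr_injective h2)
      rw [← this]
      exact h1

/-- the special form `∑ x_k g_{ik}` -/
def f0 (N o d : ℕ) : MvPolynomial (Fin 2 ⊕ Fin N) ℂ :=
  ∑ k : Fin N, X (Sum.inr k) * qq N o d k

theorem isHomogeneous_f0 (N o d : ℕ) : (f0 N o d).IsHomogeneous d := by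
  apply IsHomogeneous.sum
  intro k _
  rw [qq, Finset.mul_sum]
  apply IsHomogeneous.sum
  intro j _
  split_ifs
  · have h := (isHomogeneous_X ℂ (Sum.inr k : Fin 2 ⊕ Fin N)).mul
      (((isHomogeneous_X ℂ (Sum.inl 0 : Fin 2 ⊕ Fin N)).pow j.1).mul
      ((isHomogeneous_X ℂ (Sum.inl 1 : Fin 2 ⊕ Fin N)).pow (d - 1 - j.1)))
    convert h using 1
    omega
  · simpa using isHomogeneous_zero _ _ _

theorem coeff_f0_inr (N o d : ℕ) (j : Fin (d + 1)) :
    coeff (mon (Sum.inr j : Tt N d ⊕ Fin (d + 1))) (f0 N o d) = 0 := by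
  rw [f0, coeff_sum]
  apply Finset.sum_eq_zero
  intro k _
  rw [coeff_X_mul', if_neg]
  rw [Finsupp.mem_support_iff, not_not]
  exact mon_inr_apply j k

theorem shear_f0 (N o d : ℕ) (M : Fin 2 × Fin N → ℂ) : shear M (f0 N o d) =
    f0 N o d + ∑ k : Fin N, (C (M (0, k)) * X (Sum.inl 0) + C (M (1, k)) * X (Sum.inl 1)) *
      qq N o d k := by
  rw [f0, map_sum, ← Finset.sum_add_distrib]
  apply Finset.sum_congr rfl
  intro k _
  rw [map_mul, shear_qq]
  simp [shear, shearVar]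
  ring

theorem shear_zero {N : ℕ} (p : MvPolynomial (Fin 2 ⊕ Fin N) ℂ) : shear 0 p = p := by
  have h : (shear 0 : MvPolynomial (Fin 2 ⊕ Fin N) ℂ →ₐ[ℂ] _) = AlgHom.id ℂ _ := by
    apply MvPolynomial.algHom_ext
    rintro (a | k) <;> simp [shear, shearVar]
  rw [h]; rfl

set_option maxHeartbeats 400000 in
open Classical in
theorem phi_injective {N s : ℕ} (d : Fin s → ℕ) (hd : ∀ i, 2 ≤ d i)
    (hN : ∑ i, d i + s ≤ 2 * N) : Function.Injective (phi N d) := by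
  let c₀ : (Σ i : Fin s, Tt N (d i)) → ℂ := fun x => coeff x.2.1 (f0 N (off d x.1) (d x.1))
  let y₀ : Rr N d → ℂ := Sum.elim c₀ 0
  have hc₀ : ∀ i, hp (fun t => c₀ ⟨i, t⟩) = f0 N (off d i) (d i) := by
    intro i
    exact eq_hp (d := d i) (f0 N (off d i) (d i)) (isHomogeneous_f0 N (off d i) (d i))
      (fun j => coeff_f0_inr N (off d i) (d i) j)
  have hev : ∀ M x, phiPt c₀ M x = coeff (mon x.2) (f0 N (off d x.1) (d x.1)) -
      coeff (mon x.2) (∑ k : Fin N, (C (M (0, k)) * X (Sum.inl 0) + C (M (1, k)) * X (Sum.inl 1)) *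
      qq N (off d x.1) (d x.1) k) := by
    intro M x
    rw [phiPt, hc₀, shear_f0, coeff_add, sub_eq_add_neg, ← coeff_neg, ← Finset.sum_neg_distrib]
    congr 2
    apply Finset.sum_congr rfl
    intro k _
    simp only [Pi.neg_apply, map_neg]
    ring
  have hev0 : ∀ x, phiPt c₀ 0 x = coeff (mon x.2) (f0 N (off d x.1) (d x.1)) := by
    intro x
    rw [hev]; simp
  apply injective_of_directions _ y₀
  intro S hS
  let E : ((Σ i : Fin s, Fin (d i + 1)) → ℂ) →ₗ[ℂ] (Ss N d → ℂ) :=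
    { toFun := fun w x => Sum.elim (fun _ => 0) (fun j => w ⟨x.1, j⟩) x.2
      map_add' := by
        intro w w'
        funext ⟨i, x⟩
        rcases x with t | j <;> simp
      map_smul' := by
        intro c w
        funext ⟨i, x⟩
        rcases x with t | j <;> simp }
  have hdir : ∀ (b : Fin 2) (k : Fin N), (fun x : Ss N d =>
      coeff (mon x.2) (X (Sum.inl b) * qq N (off d x.1) (d x.1) k)) ∈ S := by
    intro b k
    let w : Rr N d → ℂ := Sum.elim (fun _ => 0) (-Pi.single (b, k) 1)
    apply hS _ w
    intro τ x
    rw [eval_phi_X, eval_phi_X]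
    have e1 : (fun t => (y₀ + τ • w) (Sum.inl t))
        = c₀ := by
      funext t; simp [y₀, w]
    have e2 : (fun t => (y₀ + τ • w) (Sum.inr t))
        = -(τ • Pi.single (b, k) (1 : ℂ)) := by
      funext t; simp [y₀, w]
    have e3 : (fun t => y₀ (Sum.inl t)) = c₀ := rfl
    have e4 : (fun t => y₀ (Sum.inr t)) = 0 := rfl
    rw [e1, e2, e3, e4, hev0, hev, sub_eq_add_neg]
    congr 1
    rw [← coeff_neg, ← coeff_C_mul]
    congr 1
    rw [Finset.sum_eq_single k]
    · fin_cases b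
      · simp [Pi.single_apply]
        ring
      · simp [Pi.single_apply]
        ring
    · intro k' _ hk'
      simp [Pi.single_apply, hk']
    · simp
  have htop : S.comap E = ⊤ := by
    apply span_all d hd hN
    · intro k
      rw [Submodule.mem_comap]
      convert hdir 1 k using 1
      funext x
      rw [coeff_X1_qq]
      rfl
    · intro k
      rw [Submodule.mem_comap]
      convert hdir 0 k using 1
      funext x
      rw [coeff_X0_qq]
      rfl
  have hT : ∀ z : (Σ i : Fin s, Tt N (d i)) → ℂ,
      (fun x : Ss N d => Sum.elim (fun t => z ⟨x.1, t⟩) (fun _ => 0) x.2) ∈ S := by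
    intro z
    let w : Rr N d → ℂ := Sum.elim z (fun _ => 0)
    apply hS _ w
    intro τ x
    rw [eval_phi_X, eval_phi_X]
    have e2 : (fun t => (y₀ + τ • w) (Sum.inr t)) = 0 := by
      funext t; simp [y₀, w]
    have e4 : (fun t => y₀ (Sum.inr t)) = 0 := rfl
    rw [e2, e4, phiPt, phiPt, neg_zero, shear_zero, shear_zero]
    rcases x with ⟨i, t | j⟩
    · rw [mon, coeff_hp_inl, coeff_hp_inl]
      simp [y₀, w]
    · rw [coeff_hp_inr, coeff_hp_inr]
      simp
  rw [eq_top_iff]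
  intro v _
  have h1 := hT (fun x => v ⟨x.1, Sum.inl x.2⟩)
  have h2 : (fun x : Σ i : Fin s, Fin (d i + 1) => v ⟨x.1, Sum.inr x.2⟩) ∈ S.comap E := by
    rw [htop]; trivial
  convert S.add_mem h1 h2 using 1
  funext ⟨i, x⟩
  rcases x with t | j <;> simp [E]

theorem eval_aeval' {σ ρ : Type} (g : σ → MvPolynomial ρ ℂ) (y : ρ → ℂ) (H : MvPolynomial σ ℂ) :
    eval y (aeval g H) = eval (fun i => eval y (g i)) H := by
  have h1 : ((aeval y).comp (aeval g) : MvPolynomial σ ℂ →ₐ[ℂ] ℂ) =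
      aeval (fun i => eval y (g i)) := by
    apply MvPolynomial.algHom_ext
    intro j
    simp [aeval_eq_eval]
  have h2 := DFunLike.congr_fun h1 H
  rw [AlgHom.comp_apply, aeval_eq_eval, aeval_eq_eval] at h2
  exact h2

/-- the general vector of the row space -/
def vec {R : Type} [CommRing R] {n N : ℕ} (e : Fin 2 ⊕ Fin N ≃ Fin (n + 1))
    (M : Fin 2 × Fin N → R) (t : Fin 2 → R) (j : Fin (n + 1)) : R :=
  Sum.elim t (fun k => M (0, k) * t 0 + M (1, k) * t 1) (e.symm j)

theorem vec_inl {R : Type} [CommRing R] {n N : ℕ} (e : Fin 2 ⊕ Fin N ≃ Fin (n + 1))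
    (M : Fin 2 × Fin N → R) (t : Fin 2 → R) (a : Fin 2) : vec e M t (e (Sum.inl a)) = t a := by
  simp [vec]

theorem vec_inr {R : Type} [CommRing R] {n N : ℕ} (e : Fin 2 ⊕ Fin N ≃ Fin (n + 1))
    (M : Fin 2 × Fin N → R) (t : Fin 2 → R) (k : Fin N) :
    vec e M t (e (Sum.inr k)) = M (0, k) * t 0 + M (1, k) * t 1 := by
  simp [vec]

theorem map_vec {R S : Type} [CommRing R] [CommRing S] (f : R →+* S) {n N : ℕ}
    (e : Fin 2 ⊕ Fin N ≃ Fin (n + 1))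
    (M : Fin 2 × Fin N → R) (t : Fin 2 → R) (j : Fin (n + 1)) :
    f (vec e M t j) = vec e (fun x => f (M x)) (fun x => f (t x)) j := by
  obtain ⟨x, rfl⟩ := e.surjective j
  rcases x with a | k
  · rw [vec_inl, vec_inl]
  · rw [vec_inr, vec_inr]; simp

/-- `W` is the graph of `M` in the chart `e`. -/
def Par {n N : ℕ} (e : Fin 2 ⊕ Fin N ≃ Fin (n + 1)) (M : Fin 2 × Fin N → ℂ)
    (W : Submodule ℂ (Fin (n + 1) → ℂ)) : Prop :=
  ∀ w, w ∈ W ↔ ∀ k, w (e (Sum.inr k)) =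
    M (0, k) * w (e (Sum.inl 0)) + M (1, k) * w (e (Sum.inl 1))

theorem Par.vec_mem {n N : ℕ} {e : Fin 2 ⊕ Fin N ≃ Fin (n + 1)} {M : Fin 2 × Fin N → ℂ}
    {W : Submodule ℂ (Fin (n + 1) → ℂ)} (h : Par e M W) (t : Fin 2 → ℂ) : vec e M t ∈ W := by
  rw [h]
  intro k
  rw [vec_inr, vec_inl, vec_inl]

theorem Par.eq_vec {n N : ℕ} {e : Fin 2 ⊕ Fin N ≃ Fin (n + 1)} {M : Fin 2 × Fin N → ℂ}
    {W : Submodule ℂ (Fin (n + 1) → ℂ)} (h : Par e M W) (w : Fin (n + 1) → ℂ) (hw : w ∈ W) :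
    w = vec e M (fun a => w (e (Sum.inl a))) := by
  funext j
  obtain ⟨x, rfl⟩ := e.surjective j
  rcases x with a | k
  · rw [vec_inl]
  · rw [vec_inr, (h w).mp hw k]

theorem Par.unique {n N : ℕ} {e : Fin 2 ⊕ Fin N ≃ Fin (n + 1)} {M M' : Fin 2 × Fin N → ℂ}
    {W : Submodule ℂ (Fin (n + 1) → ℂ)} (h : Par e M W) (h' : Par e M' W) : M = M' := by
  funext ⟨b, k⟩
  have h1 := (h' _).mp (h.vec_mem ![1, 0]) k
  have h2 := (h' _).mp (h.vec_mem ![0, 1]) k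
  rw [vec_inr, vec_inl, vec_inl] at h1 h2
  fin_cases b
  · simpa using h1
  · simpa using h2

/-- the Plücker minor -/
def deltaPoly {n N : ℕ} (e : Fin 2 ⊕ Fin N ≃ Fin (n + 1)) :
    MvPolynomial (Fin (n + 1) ⊕ Fin (n + 1)) ℂ :=
  X (Sum.inl (e (Sum.inl 0))) * X (Sum.inr (e (Sum.inl 1))) -
    X (Sum.inl (e (Sum.inl 1))) * X (Sum.inr (e (Sum.inl 0)))

theorem eval_deltaPoly {n N : ℕ} (e : Fin 2 ⊕ Fin N ≃ Fin (n + 1)) (u v : Fin (n + 1) → ℂ) :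
    eval (Sum.elim u v) (deltaPoly e) = u (e (Sum.inl 0)) * v (e (Sum.inl 1)) -
      u (e (Sum.inl 1)) * v (e (Sum.inl 0)) := by
  simp [deltaPoly]

theorem exists_Par {n N : ℕ} (e : Fin 2 ⊕ Fin N ≃ Fin (n + 1)) (W : ProjLine n)
    (hW : ¬ ∀ u ∈ W.1, ∀ v ∈ W.1, eval (Sum.elim u v) (deltaPoly e) = 0) :
    ∃ M, Par e M W.1 := by
  push Not at hW
  obtain ⟨u, hu, v, hv, huv⟩ := hW
  rw [eval_deltaPoly] at huv
  set Δ := u (e (Sum.inl 0)) * v (e (Sum.inl 1)) - u (e (Sum.inl 1)) * v (e (Sum.inl 0)) with hΔ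
  let L : W.1 →ₗ[ℂ] (Fin 2 → ℂ) :=
    (LinearMap.funLeft ℂ ℂ (fun a : Fin 2 => e (Sum.inl a))).comp W.1.subtype
  have hsurj : Function.Surjective L := by
    intro t
    refine ⟨((t 0 * v (e (Sum.inl 1)) - t 1 * v (e (Sum.inl 0))) / Δ) • ⟨u, hu⟩ +
      ((t 1 * u (e (Sum.inl 0)) - t 0 * u (e (Sum.inl 1))) / Δ) • ⟨v, hv⟩, ?_⟩
    funext a
    simp only [L, LinearMap.comp_apply, LinearMap.funLeft_apply, Submodule.subtype_apply,
      Submodule.coe_add, Submodule.coe_smul, Pi.add_apply, Pi.smul_apply, smul_eq_mul]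
    fin_cases a
    · field_simp
      simp only [hΔ, Fin.zero_eta]
      ring
    · field_simp
      simp only [hΔ, Fin.mk_one]
      ring
  have hfd : FiniteDimensional ℂ W.1 := inferInstance
  have hinj : Function.Injective L :=
    (LinearMap.injective_iff_surjective_of_finrank_eq_finrank (by rw [W.2]; simp)).mpr hsurj
  refine ⟨fun x => if x.1 = 0
    then (u (e (Sum.inr x.2)) * v (e (Sum.inl 1)) - u (e (Sum.inl 1)) * v (e (Sum.inr x.2))) / Δ
    else (u (e (Sum.inl 0)) * v (e (Sum.inr x.2)) - u (e (Sum.inr x.2)) * v (e (Sum.inl 0))) / Δ,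
    ?_⟩
  intro w
  have hcomb : ∀ w : Fin (n + 1) → ℂ, w ∈ W.1 →
      w = ((w (e (Sum.inl 0)) * v (e (Sum.inl 1)) - w (e (Sum.inl 1)) * v (e (Sum.inl 0))) / Δ) • u
      + ((w (e (Sum.inl 1)) * u (e (Sum.inl 0)) - w (e (Sum.inl 0)) * u (e (Sum.inl 1))) / Δ) • v := by
    intro w hw
    have h := @hinj ⟨w, hw⟩ (((w (e (Sum.inl 0)) * v (e (Sum.inl 1)) -
      w (e (Sum.inl 1)) * v (e (Sum.inl 0))) / Δ) • ⟨u, hu⟩ +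
      ((w (e (Sum.inl 1)) * u (e (Sum.inl 0)) - w (e (Sum.inl 0)) * u (e (Sum.inl 1))) / Δ)
        • ⟨v, hv⟩) (by
        funext a
        simp only [L, LinearMap.comp_apply, LinearMap.funLeft_apply, Submodule.subtype_apply,
          Submodule.coe_add, Submodule.coe_smul, Pi.add_apply, Pi.smul_apply, smul_eq_mul]
        fin_cases a
        · field_simp
          simp only [hΔ, Fin.zero_eta]
          ring
        · field_simp
          simp only [hΔ, Fin.mk_one]
          ring)
    exact congrArg Subtype.val h
  constructor
  · intro hw k
    have h := congrFun (hcomb w hw) (e (Sum.inr k))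
    rw [h]
    simp only [Pi.add_apply, Pi.smul_apply, smul_eq_mul, if_true, one_ne_zero, if_false]
    field_simp
    ring
  · intro h
    have : w = ((w (e (Sum.inl 0)) * v (e (Sum.inl 1)) - w (e (Sum.inl 1)) * v (e (Sum.inl 0))) / Δ) • u
      + ((w (e (Sum.inl 1)) * u (e (Sum.inl 0)) - w (e (Sum.inl 0)) * u (e (Sum.inl 1))) / Δ) • v := by
      funext j
      obtain ⟨x, rfl⟩ := e.surjective j
      rcases x with a | k
      · simp only [Pi.add_apply, Pi.smul_apply, smul_eq_mul]
        fin_cases a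
        · field_simp
          simp only [hΔ, Fin.zero_eta]
          ring
        · field_simp
          simp only [hΔ, Fin.mk_one]
          ring
      · rw [h k]
        simp only [Pi.add_apply, Pi.smul_apply, smul_eq_mul, if_true, one_ne_zero, if_false]
        field_simp
        ring
    rw [this]
    exact W.1.add_mem (W.1.smul_mem _ hu) (W.1.smul_mem _ hv)

theorem exists_line {n N : ℕ} (e : Fin 2 ⊕ Fin N ≃ Fin (n + 1)) (M : Fin 2 × Fin N → ℂ) :
    ∃ W : ProjLine n, Par e M W.1 := by
  let W : Submodule ℂ (Fin (n + 1) → ℂ) :=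
    { carrier := {w | ∀ k, w (e (Sum.inr k)) =
        M (0, k) * w (e (Sum.inl 0)) + M (1, k) * w (e (Sum.inl 1))}
      add_mem' := by
        intro a b ha hb k
        simp only [Pi.add_apply, ha k, hb k]
        ring
      zero_mem' := by intro k; simp
      smul_mem' := by
        intro c a ha k
        simp only [Pi.smul_apply, smul_eq_mul, ha k]
        ring }
  have hP : Par e M W := fun w => Iff.rfl
  let L : W →ₗ[ℂ] (Fin 2 → ℂ) :=
    (LinearMap.funLeft ℂ ℂ (fun a : Fin 2 => e (Sum.inl a))).comp W.subtype
  have hbij : Function.Bijective L := by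
    constructor
    · intro w w' h
      apply Subtype.ext
      rw [hP.eq_vec _ w.2, hP.eq_vec _ w'.2]
      exact congrArg (vec e M) h
    · intro t
      refine ⟨⟨vec e M t, hP.vec_mem t⟩, ?_⟩
      funext a
      exact vec_inl e M t a
  refine ⟨⟨W, ?_⟩, hP⟩
  rw [(LinearEquiv.ofBijective L hbij).finrank_eq]
  simp

theorem Par.delta {n N : ℕ} {e : Fin 2 ⊕ Fin N ≃ Fin (n + 1)} {M : Fin 2 × Fin N → ℂ}
    {W : Submodule ℂ (Fin (n + 1) → ℂ)} (h : Par e M W) :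
    ¬ ∀ u ∈ W, ∀ v ∈ W, eval (Sum.elim u v) (deltaPoly e) = 0 := by
  intro h'
  have := h' _ (h.vec_mem ![1, 0]) _ (h.vec_mem ![0, 1])
  rw [eval_deltaPoly] at this
  simp [vec_inl] at this

theorem exists_chart {n N : ℕ} (hN : N + 1 = n) (W : ProjLine n) :
    ∃ e : Fin 2 ⊕ Fin N ≃ Fin (n + 1),
      ¬ ∀ u ∈ W.1, ∀ v ∈ W.1, eval (Sum.elim u v) (deltaPoly e) = 0 := by
  have h1 : 1 < Module.finrank ℂ W.1 := by rw [W.2]; norm_num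
  have hnt : Nontrivial W.1 := Module.nontrivial_of_finrank_pos (R := ℂ) (by omega)
  obtain ⟨u, hu⟩ := exists_ne (0 : W.1)
  obtain ⟨p, hp⟩ : ∃ p, u.1 p ≠ 0 := by
    by_contra hc
    push Not at hc
    exact hu (Subtype.ext (funext hc))
  obtain ⟨v, hv⟩ : ∃ v : W.1, ∀ c : ℂ, c • u ≠ v := by
    by_contra hc
    push Not at hc
    have := finrank_le_one u hc
    omega
  let v' : W.1 := v - (v.1 p / u.1 p) • u
  have hv' : v' ≠ 0 := by
    intro h
    exact hv _ (sub_eq_zero.mp h).symm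
  have hv'p : v'.1 p = 0 := by
    simp only [v', Submodule.coe_sub, Submodule.coe_smul, Pi.sub_apply, Pi.smul_apply, smul_eq_mul]
    field_simp
    ring
  obtain ⟨q, hq⟩ : ∃ q, v'.1 q ≠ 0 := by
    by_contra hc
    push Not at hc
    exact hv' (Subtype.ext (funext hc))
  have hpq : p ≠ q := by
    rintro rfl
    exact hq hv'p
  let e₀ : Fin 2 ⊕ Fin N ≃ Fin (n + 1) := finSumFinEquiv.trans (finCongr (by omega))
  let π₁ := Equiv.swap (e₀ (Sum.inl 0)) p
  let r := π₁ (e₀ (Sum.inl 1))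
  have hr : p ≠ r := by
    intro h
    have h2 : π₁ (e₀ (Sum.inl 0)) = π₁ (e₀ (Sum.inl 1)) := by
      rw [← show r = π₁ (e₀ (Sum.inl 1)) from rfl, ← h]
      exact Equiv.swap_apply_left _ _
    have := e₀.injective (π₁.injective h2)
    simp at this
  let e := (e₀.trans π₁).trans (Equiv.swap r q)
  have e0 : e (Sum.inl 0) = p := by
    show Equiv.swap r q (π₁ (e₀ (Sum.inl 0))) = p
    rw [show π₁ (e₀ (Sum.inl 0)) = p from Equiv.swap_apply_left _ _]
    exact Equiv.swap_apply_of_ne_of_ne hr hpq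
  have e1 : e (Sum.inl 1) = q := Equiv.swap_apply_left _ _
  refine ⟨e, fun h => ?_⟩
  have := h _ u.2 _ v'.2
  rw [eval_deltaPoly, e0, e1, hv'p, mul_zero, sub_zero] at this
  exact mul_ne_zero hp hq this

theorem eval_smul_homog {n d : ℕ} (p : MvPolynomial (Fin n) ℂ) (hp : p.IsHomogeneous d) (a : ℂ)
    (w : Fin n → ℂ) : eval (a • w) p = a ^ d * eval w p := by
  rw [eval_eq', eval_eq', Finset.mul_sum]
  apply Finset.sum_congr rfl
  intro m hm
  have hdeg : m.degree = d := by
    by_contra h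
    exact (mem_support_iff.mp hm) (hp.coeff_eq_zero h)
  simp only [Pi.smul_apply, smul_eq_mul, mul_pow, Finset.prod_mul_distrib]
  rw [Finset.prod_pow_eq_pow_sum, ← Finsupp.degree_eq_sum, hdeg]
  ring

theorem mem_fano_iff {n s : ℕ} {d : Fin s → ℕ} (hd : ∀ i, 2 ≤ d i)
    (f : Fin s → MvPolynomial (Fin (n + 1)) ℂ) (hf : ∀ i, (f i).IsHomogeneous (d i))
    (W : ProjLine n) :
    W ∈ fanoLines (projZeroLocus f) ↔ ∀ w ∈ W.1, ∀ i, eval w (f i) = 0 := by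
  constructor
  · intro h w hw i
    by_cases hw0 : w = 0
    · have := eval_smul_homog (f i) (hf i) 0 0
      rw [zero_pow (by have := hd i; omega), zero_mul, smul_zero] at this
      rw [hw0, this]
    · obtain ⟨a, ha⟩ := Projectivization.exists_smul_eq_mk_rep ℂ w hw0
      have hmem : (Projectivization.mk ℂ w hw0) ∈ lineSet W.1 := by
        show (Projectivization.mk ℂ w hw0).rep ∈ W.1
        rw [← ha]
        exact W.1.smul_mem _ hw
      have h2 := h hmem i
      rw [← ha] at h2
      have h3 := eval_smul_homog (f i) (hf i) a w
      rw [show (a : ℂ) • w = a • w from rfl, h2] at h3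
      rcases mul_eq_zero.mp h3.symm with h4 | h4
      · exact absurd ((pow_eq_zero_iff (by have := hd i; omega)).mp h4) a.ne_zero
      · exact h4
  · intro h x hx i
    exact h _ hx i

theorem eval_shear {N : ℕ} (M : Fin 2 × Fin N → ℂ) (p : MvPolynomial (Fin 2 ⊕ Fin N) ℂ)
    (t : Fin 2 → ℂ) : eval (Sum.elim t 0) (shear M p) =
      eval (Sum.elim t (fun k => M (0, k) * t 0 + M (1, k) * t 1)) p := by
  rw [shear, eval_aeval']
  congr 1
  apply congrArg
  funext x
  rcases x with a | k <;> simp [shearVar]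

theorem eval_vec {n N : ℕ} (e : Fin 2 ⊕ Fin N ≃ Fin (n + 1)) (M : Fin 2 × Fin N → ℂ)
    (t : Fin 2 → ℂ) (f : MvPolynomial (Fin (n + 1)) ℂ) :
    eval (vec e M t) f = eval (Sum.elim t 0) (shear M (rename e.symm f)) := by
  rw [eval_shear, eval_rename]
  rfl

theorem coeffs_zero_iff {N d : ℕ} (p : MvPolynomial (Fin 2 ⊕ Fin N) ℂ) (hp' : p.IsHomogeneous d) :
    (∀ t : Fin 2 → ℂ, eval (Sum.elim t 0) p = 0) ↔
      ∀ j : Fin (d + 1), coeff (mon (Sum.inr j : Tt N d ⊕ Fin (d + 1))) p = 0 := by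
  have hdec : p = hp (fun t : Tt N d => coeff t.1 p) + ∑ j : Fin (d + 1),
      monomial (mon (Sum.inr j : Tt N d ⊕ Fin (d + 1)))
        (coeff (mon (Sum.inr j : Tt N d ⊕ Fin (d + 1))) p) := by
    classical
    apply eq_of_coeff_mon p _ hp'
    · refine (isHomogeneous_hp _).add ?_
      apply IsHomogeneous.sum
      intro j _
      exact isHomogeneous_monomial _ (mon_degree _)
    · rintro (t | j)
      · rw [coeff_add, coeff_sum, Finset.sum_eq_zero]
        · rw [mon, coeff_hp_inl, add_zero]
        · intro j _
          rw [coeff_monomial, if_neg]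
          intro h
          have := mon_injective h
          simp at this
      · rw [coeff_add, coeff_hp_inr, coeff_sum, Finset.sum_eq_single j]
        · simp
        · intro j' _ hj'
          rw [coeff_monomial, if_neg]
          intro h
          exact hj' (Sum.inr_injective (mon_injective h))
        · simp
  have hhp : ∀ (c : Tt N d → ℂ) (t : Fin 2 → ℂ), eval (Sum.elim t 0) (hp c) = 0 := by
    intro c t
    rw [hp, map_sum]
    apply Finset.sum_eq_zero
    intro m _
    obtain ⟨k, hk⟩ := m.2.2
    rw [eval_monomial, Finsupp.prod, Finset.prod_eq_zero (i := Sum.inr k), mul_zero]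
    · exact Finsupp.mem_support_iff.mpr hk
    · simp [zero_pow hk]
  have hmon : ∀ (j : Fin (d + 1)) (c : ℂ) (t : Fin 2 → ℂ), eval (Sum.elim t 0)
      (monomial (mon (Sum.inr j : Tt N d ⊕ Fin (d + 1))) c) = c * (t 0 ^ j.1 * t 1 ^ (d - j.1)) := by
    intro j c t
    have : (monomial (mon (Sum.inr j : Tt N d ⊕ Fin (d + 1))) c) =
        C c * (monomial (mon (Sum.inr j : Tt N d ⊕ Fin (d + 1))) 1) := by
      rw [C_mul_monomial, mul_one]
    rw [this, monomial_mon_inr]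
    simp
  have hev : ∀ t : Fin 2 → ℂ, eval (Sum.elim t 0) p = ∑ j : Fin (d + 1),
      coeff (mon (Sum.inr j : Tt N d ⊕ Fin (d + 1))) p * (t 0 ^ j.1 * t 1 ^ (d - j.1)) := by
    intro t
    conv_lhs => rw [hdec]
    rw [map_add, hhp, zero_add, map_sum]
    exact Finset.sum_congr rfl (fun j _ => hmon _ _ _)
  constructor
  · intro h j
    let P : Polynomial ℂ := ∑ j : Fin (d + 1),
      Polynomial.monomial j.1 (coeff (mon (Sum.inr j : Tt N d ⊕ Fin (d + 1))) p)
    have hP : P = 0 := by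
      apply Polynomial.funext
      intro r
      have := h ![r, 1]
      rw [hev] at this
      simp only [P, Polynomial.eval_finsetSum, Polynomial.eval_monomial, Polynomial.eval_zero]
      simpa using this
    have h2 : P.coeff j = coeff (mon (Sum.inr j : Tt N d ⊕ Fin (d + 1))) p := by
      simp only [P, Polynomial.finsetSum_coeff, Polynomial.coeff_monomial]
      rw [Finset.sum_eq_single j]
      · simp
      · intro b _ hb
        rw [if_neg (fun h => hb (Fin.ext h))]
      · simp
    rw [← h2, hP, Polynomial.coeff_zero]
  · intro h t
    rw [hev]
    apply Finset.sum_eq_zero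
    intro j _
    rw [h, zero_mul]

theorem Par.mem_fano_iff {n N s : ℕ} {d : Fin s → ℕ} (hd : ∀ i, 2 ≤ d i)
    (f : Fin s → MvPolynomial (Fin (n + 1)) ℂ) (hf : ∀ i, (f i).IsHomogeneous (d i))
    {e : Fin 2 ⊕ Fin N ≃ Fin (n + 1)} {M : Fin 2 × Fin N → ℂ}
    {W : ProjLine n} (h : Par e M W.1) :
    W ∈ fanoLines (projZeroLocus f) ↔ ∀ i, ∀ j : Fin (d i + 1),
      coeff (mon (Sum.inr j : Tt N (d i) ⊕ Fin (d i + 1)))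
        (shear M (rename e.symm (f i))) = 0 := by
  rw [_root_.mem_fano_iff hd f hf]
  have h1 : ∀ i, (shear M (rename e.symm (f i))).IsHomogeneous (d i) := fun i =>
    isHomogeneous_shear _ _ ((hf i).rename_isHomogeneous)
  constructor
  · intro h2 i
    rw [← coeffs_zero_iff _ (h1 i)]
    intro t
    rw [← eval_vec]
    exact h2 _ (h.vec_mem t) i
  · intro h2 w hw i
    rw [h.eq_vec w hw, eval_vec]
    exact (coeffs_zero_iff _ (h1 i)).mpr (h2 i) _

theorem exists_F {n N : ℕ} (e : Fin 2 ⊕ Fin N ≃ Fin (n + 1)) (H : MvPolynomial (Fin 2 × Fin N) ℂ) :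
    ∃ (D : ℕ) (F : MvPolynomial (Fin (n + 1) ⊕ Fin (n + 1)) ℂ),
      ∀ (M : Fin 2 × Fin N → ℂ) (t t' : Fin 2 → ℂ),
        eval (Sum.elim (vec e M t) (vec e M t')) F = (t 0 * t' 1 - t 1 * t' 0) ^ D * eval M H := by
  have hdelta : ∀ (M : Fin 2 × Fin N → ℂ) (t t' : Fin 2 → ℂ),
      eval (Sum.elim (vec e M t) (vec e M t')) (deltaPoly e) = t 0 * t' 1 - t 1 * t' 0 := by
    intro M t t'
    rw [eval_deltaPoly]
    simp only [vec_inl]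
  induction H using MvPolynomial.induction_on with
  | C a => exact ⟨0, C a, fun M t t' => by simp⟩
  | add p q hp hq =>
    obtain ⟨D₁, F₁, h₁⟩ := hp
    obtain ⟨D₂, F₂, h₂⟩ := hq
    refine ⟨D₁ + D₂, F₁ * deltaPoly e ^ D₂ + F₂ * deltaPoly e ^ D₁, fun M t t' => ?_⟩
    rw [map_add, map_mul, map_mul, map_pow, map_pow, h₁, h₂, hdelta, map_add]
    ring
  | mul_X p x hp =>
    obtain ⟨D, F, h⟩ := hp
    obtain ⟨b, k⟩ := x
    fin_cases b
    · refine ⟨D + 1, F * (X (Sum.inl (e (Sum.inr k))) * X (Sum.inr (e (Sum.inl 1))) -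
        X (Sum.inl (e (Sum.inl 1))) * X (Sum.inr (e (Sum.inr k)))), fun M t t' => ?_⟩
      rw [map_mul, h, map_sub, map_mul, map_mul, map_mul, eval_X, eval_X, eval_X, eval_X, eval_X,
        Sum.elim_inl, Sum.elim_inr, Sum.elim_inl, Sum.elim_inr, vec_inr, vec_inl, vec_inl, vec_inr]
      simp only [Fin.zero_eta]
      ring
    · refine ⟨D + 1, F * (X (Sum.inl (e (Sum.inl 0))) * X (Sum.inr (e (Sum.inr k))) -
        X (Sum.inl (e (Sum.inr k))) * X (Sum.inr (e (Sum.inl 0)))), fun M t t' => ?_⟩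
      rw [map_mul, h, map_sub, map_mul, map_mul, map_mul, eval_X, eval_X, eval_X, eval_X, eval_X,
        Sum.elim_inl, Sum.elim_inr, Sum.elim_inl, Sum.elim_inr, vec_inr, vec_inl, vec_inl, vec_inr]
      simp only [Fin.mk_one]
      ring

/-- chart of the Fano variety -/
def chartSet {n N : ℕ} (e : Fin 2 ⊕ Fin N ≃ Fin (n + 1)) (A : Set (ProjLine n)) : Set A :=
  {W | ¬ ∀ u ∈ W.1.1, ∀ v ∈ W.1.1, eval (Sum.elim u v) (deltaPoly e) = 0}

theorem isOpen_D {n : ℕ} (F : MvPolynomial (Fin (n + 1) ⊕ Fin (n + 1)) ℂ) :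
    IsOpen {W : ProjLine n | ¬ ∀ u ∈ W.1, ∀ v ∈ W.1, eval (Sum.elim u v) F = 0} :=
  TopologicalSpace.isOpen_generateFrom_of_mem ⟨F, rfl⟩

theorem isOpen_chartSet {n N : ℕ} (e : Fin 2 ⊕ Fin N ≃ Fin (n + 1)) (A : Set (ProjLine n)) :
    IsOpen (chartSet e A) :=
  (isOpen_D (deltaPoly e)).preimage continuous_subtype_val

theorem chart_dim {n N s : ℕ} {d : Fin s → ℕ} (hd : ∀ i, 2 ≤ d i)
    (f : Fin s → MvPolynomial (Fin (n + 1)) ℂ) (hf : ∀ i, (f i).IsHomogeneous (d i))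
    (e : Fin 2 ⊕ Fin N ≃ Fin (n + 1)) :
    topologicalKrullDim (chartSet e (fanoLines (projZeroLocus f))) =
      ringKrullDim (MvPolynomial (Rr N d) ℂ ⧸ Ideal.span (Set.range fun x : Ss N d =>
        phi N d (X x) - C (coeff (mon x.2) (rename e.symm (f x.1))))) := by
  have hex : ∀ z : chartSet e (fanoLines (projZeroLocus f)), ∃ M, Par e M z.1.1.1 := fun z =>
    exists_Par e z.1.1 z.2
  choose Mz hMz using hex
  have hf' : ∀ i, (rename e.symm (f i)).IsHomogeneous (d i) := fun i =>
    (hf i).rename_isHomogeneous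
  let cof : (Fin 2 × Fin N → ℂ) → Rr N d → ℂ := fun M =>
    Sum.elim (fun x => coeff x.2.1 (shear M (rename e.symm (f x.1)))) M
  let pt : chartSet e (fanoLines (projZeroLocus f)) → Rr N d → ℂ := fun z => cof (Mz z)
  have hzero : ∀ y : Rr N d → ℂ, (∀ p ∈ Ideal.span (Set.range fun x : Ss N d =>
        phi N d (X x) - C (coeff (mon x.2) (rename e.symm (f x.1)))), eval y p = 0) ↔
      ∀ i, hp (fun t => y (Sum.inl ⟨i, t⟩)) =
        shear (fun t => y (Sum.inr t)) (rename e.symm (f i)) := by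
    intro y
    rw [← phiPt_eq_iff (fun i => rename e.symm (f i)) hf'
      (fun t => y (Sum.inl t)) (fun t => y (Sum.inr t))]
    constructor
    · intro h x
      have := h _ (Ideal.subset_span ⟨x, rfl⟩)
      rw [map_sub, eval_phi_X, eval_C, sub_eq_zero] at this
      exact this
    · intro h p hp
      have hle : Ideal.span (Set.range fun x : Ss N d =>
          phi N d (X x) - C (coeff (mon x.2) (rename e.symm (f x.1)))) ≤ RingHom.ker (eval y) := by
        rw [Ideal.span_le]
        rintro _ ⟨x, rfl⟩
        rw [SetLike.mem_coe, RingHom.mem_ker, map_sub, eval_phi_X, eval_C, sub_eq_zero]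
        exact h x
      exact hle hp
  apply dim_of_chart _ pt
  · ext y
    rw [Set.mem_ofPred_eq, hzero]
    constructor
    · rintro ⟨z, rfl⟩ i
      have h1 := ((hMz z).mem_fano_iff hd f hf).mp z.1.2 i
      exact eq_hp (d := d i) (shear (Mz z) (rename e.symm (f i)))
        (isHomogeneous_shear (Mz z) (rename e.symm (f i)) (hf' i)) h1
    · intro h
      obtain ⟨W, hW⟩ := exists_line e (fun t => y (Sum.inr t))
      have hWf : W ∈ fanoLines (projZeroLocus f) := by
        rw [hW.mem_fano_iff hd f hf]
        intro i j
        rw [← h i, coeff_hp_inr]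
      refine ⟨⟨⟨W, hWf⟩, hW.delta⟩, ?_⟩
      have hM := (hMz ⟨⟨W, hWf⟩, hW.delta⟩).unique hW
      show cof _ = y
      rw [hM]
      funext x
      rcases x with ⟨i, t⟩ | t
      · show coeff t.1 _ = _
        rw [← h i, coeff_hp_inl]
      · rfl
  · intro H
    let H' : MvPolynomial (Fin 2 × Fin N) ℂ := aeval (Sum.elim
      (fun x : (Σ i : Fin s, Tt N (d i)) =>
        coeff x.2.1 (shear (fun t => X t) (map C (rename e.symm (f x.1))))) (fun t => X t)) H
    have hH' : ∀ M, eval M H' = eval (cof M) H := by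
      intro M
      simp only [H']
      rw [eval_aeval']
      congr 1
      apply congrArg
      funext x
      rcases x with ⟨i, t⟩ | t
      · simp only [Sum.elim_inl, cof]
        rw [← coeff_map, map_shear, map_map]
        have : (eval M).comp (C : ℂ →+* MvPolynomial (Fin 2 × Fin N) ℂ) = RingHom.id ℂ := by
          ext; simp
        rw [this, map_id]
        simp
      · simp [cof]
    obtain ⟨D, F, hF⟩ := exists_F e H'
    have hset : {z | eval (pt z) H ≠ 0} = (fun z : chartSet e (fanoLines (projZeroLocus f)) =>
        z.1.1) ⁻¹' {W : ProjLine n | ¬ ∀ u ∈ W.1, ∀ v ∈ W.1, eval (Sum.elim u v) F = 0} := by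
      ext z
      simp only [Set.mem_ofPred_eq, Set.mem_preimage]
      rw [not_iff_not, show pt z = cof (Mz z) from rfl, ← hH']
      constructor
      · intro h u hu v hv
        rw [(hMz z).eq_vec u hu, (hMz z).eq_vec v hv, hF, h, mul_zero]
      · intro h
        have := h _ ((hMz z).vec_mem ![1, 0]) _ ((hMz z).vec_mem ![0, 1])
        rw [hF] at this
        simpa using this
    rw [hset]
    exact (isOpen_D F).preimage (continuous_subtype_val.comp continuous_subtype_val)
  · intro z U hz hU
    obtain ⟨U₁, hU₁, rfl⟩ := isOpen_induced_iff.mp hU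
    obtain ⟨U₂, hU₂, rfl⟩ := isOpen_induced_iff.mp hU₁
    have key : ∀ z : chartSet e (fanoLines (projZeroLocus f)), z.1.1 ∈ U₂ →
        ∃ H, eval (pt z) H ≠ 0 ∧ ∀ z' : chartSet e (fanoLines (projZeroLocus f)),
          eval (pt z') H ≠ 0 → z'.1.1 ∈ U₂ := by
      clear hz hU hU₁ z
      induction hU₂ with
      | basic S hS =>
        obtain ⟨F, rfl⟩ := hS
        intro z hz
        rw [Set.mem_ofPred_eq] at hz
        push Not at hz
        obtain ⟨u, hu, v, hv, huv⟩ := hz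
        let H : MvPolynomial (Rr N d) ℂ := aeval (Sum.elim
          (vec e (fun t => X (Sum.inr t)) (fun a => C (u (e (Sum.inl a)))))
          (vec e (fun t => X (Sum.inr t)) (fun a => C (v (e (Sum.inl a)))))) F
        have hH : ∀ z', eval (pt z') H = eval (Sum.elim
            (vec e (Mz z') (fun a => u (e (Sum.inl a))))
            (vec e (Mz z') (fun a => v (e (Sum.inl a))))) F := by
          intro z'
          simp only [H]
          rw [eval_aeval']
          congr 1
          apply congrArg
          funext x
          rcases x with j | j
          · simp only [Sum.elim_inl]
            rw [map_vec]
            simp [pt, cof]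
          · simp only [Sum.elim_inr]
            rw [map_vec]
            simp [pt, cof]
        refine ⟨H, ?_, ?_⟩
        · rw [hH, ← (hMz z).eq_vec u hu, ← (hMz z).eq_vec v hv]
          exact huv
        · intro z' hz' hc
          apply hz'
          rw [hH]
          exact hc _ ((hMz z').vec_mem _) _ ((hMz z').vec_mem _)
      | univ => exact fun z _ => ⟨1, by simp, fun _ _ => trivial⟩
      | inter S T _ _ ihS ihT =>
        intro z hz
        obtain ⟨H₁, h₁, h₁'⟩ := ihS z hz.1
        obtain ⟨H₂, h₂, h₂'⟩ := ihT z hz.2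
        refine ⟨H₁ * H₂, by rw [map_mul]; exact mul_ne_zero h₁ h₂, ?_⟩
        intro z' hz'
        rw [map_mul] at hz'
        exact ⟨h₁' z' (left_ne_zero_of_mul hz'), h₂' z' (right_ne_zero_of_mul hz')⟩
      | sUnion S _ ih =>
        intro z hz
        obtain ⟨T, hT, hzT⟩ := hz
        obtain ⟨H, h, h'⟩ := ih T hT z hzT
        exact ⟨H, h, fun z' hz' => ⟨T, hT, h' z' hz'⟩⟩
    exact key z hz

theorem degree_mapDomain_equiv {A B : Type} (e : A ≃ B) (m : A →₀ ℕ) :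
    (Finsupp.mapDomain e m).degree = m.degree := by
  classical
  exact Finsupp.sum_mapDomain_index_addMonoidHom (fun _ => AddMonoidHom.id ℕ) (f := e) (s := m)

def idx {n N s : ℕ} (d : Fin s → ℕ) (e : Fin 2 ⊕ Fin N ≃ Fin (n + 1)) (x : Ss N d) :
    Fin s × (Fin (n + 1) →₀ ℕ) := (x.1, Finsupp.mapDomain e (mon x.2))

theorem idx_injective {n N s : ℕ} (d : Fin s → ℕ) (e : Fin 2 ⊕ Fin N ≃ Fin (n + 1)) :
    Function.Injective (idx d e) := by
  rintro ⟨i, x⟩ ⟨j, y⟩ h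
  simp only [idx, Prod.mk.injEq] at h
  obtain ⟨rfl, h⟩ := h
  have := mon_injective (Finsupp.mapDomain_injective e.injective h)
  rw [this]

theorem coeff_idx {n N s : ℕ} (d : Fin s → ℕ) (e : Fin 2 ⊕ Fin N ≃ Fin (n + 1)) (x : Ss N d)
    (f : Fin s → MvPolynomial (Fin (n + 1)) ℂ) :
    coeff (idx d e x).2 (f (idx d e x).1) = coeff (mon x.2) (rename e.symm (f x.1)) := by
  have h : f x.1 = rename e (rename e.symm (f x.1)) := by
    rw [rename_rename]; simp
  show coeff (Finsupp.mapDomain e (mon x.2)) (f x.1) = _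
  conv_lhs => rw [h]
  rw [coeff_rename_mapDomain _ e.injective]

theorem exists_tuple {n N s : ℕ} (d : Fin s → ℕ) (e₀ : Fin 2 ⊕ Fin N ≃ Fin (n + 1))
    (a : Fin s × (Fin (n + 1) →₀ ℕ) → ℂ) :
    ∃ f₀ : Fin s → MvPolynomial (Fin (n + 1)) ℂ, (∀ i, (f₀ i).IsHomogeneous (d i)) ∧
      ∀ i m, m.degree = d i → coeff m (f₀ i) = a (i, m) := by
  classical
  refine ⟨fun i => ∑ y : Tt N (d i) ⊕ Fin (d i + 1),
    monomial (Finsupp.mapDomain e₀ (mon y)) (a (i, Finsupp.mapDomain e₀ (mon y))), ?_, ?_⟩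
  · intro i
    refine IsHomogeneous.sum _ _ _ fun y _ => ?_
    exact isHomogeneous_monomial _ (by rw [degree_mapDomain_equiv, mon_degree])
  · intro i m hm
    obtain ⟨y, hy⟩ := mon_surj (d := d i) (Finsupp.mapDomain e₀.symm m)
      (by rw [degree_mapDomain_equiv, hm])
    have hy' : Finsupp.mapDomain e₀ (mon y) = m := by
      rw [hy, ← Finsupp.mapDomain_comp]; simp
    subst hy'
    rw [coeff_sum, Finset.sum_eq_single y]
    · rw [coeff_monomial, if_pos rfl]
    · intro b _ hb
      rw [coeff_monomial, if_neg]
      intro h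
      exact hb (mon_injective (Finsupp.mapDomain_injective e₀.injective h))
    · simp

theorem main_thm
    (n s : ℕ) (d : Fin s → ℕ) (hd : ∀ i, 2 ≤ d i)
    (hle : ∑ i, d i + s + 2 ≤ 2 * n) :
    GenericHolds n d (fun f =>
      topologicalKrullDim ↥(fanoLines (projZeroLocus f)) =
        ((2 * n - ∑ i, d i - s - 2 : ℕ) : WithBot ℕ∞)) := by
  classical
  obtain ⟨N, rfl⟩ : ∃ N, n = N + 1 := ⟨n - 1, by omega⟩
  obtain ⟨δ, hδ⟩ : ∃ δ, δ = 2 * (N + 1) - ∑ i, d i - s - 2 := ⟨_, rfl⟩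
  rw [← hδ]
  have e₀ : Fin 2 ⊕ Fin N ≃ Fin (N + 1 + 1) := finSumFinEquiv.trans (finCongr (by omega))
  obtain ⟨g₁, hg₁, hdim⟩ := generic_fiber δ (card_Rr N d δ (by omega)) (phi N d)
    (phi_injective d hd (by omega))
  let g : MvPolynomial (Fin s × ((Fin (N + 1 + 1)) →₀ ℕ)) ℂ :=
    ∏ e : Fin 2 ⊕ Fin N ≃ Fin (N + 1 + 1), rename (idx d e) g₁
  have hg : g ≠ 0 := by
    refine Finset.prod_ne_zero_iff.mpr fun e _ h => hg₁ ?_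
    exact rename_injective _ (idx_injective d e) (by rw [h, map_zero])
  refine ⟨g, ?_, ?_⟩
  · obtain ⟨a, ha⟩ : ∃ a, eval a g ≠ 0 := by
      by_contra hc
      push Not at hc
      exact hg (MvPolynomial.funext fun x => by rw [hc, map_zero])
    obtain ⟨f₀, hf₀, hc⟩ := exists_tuple d e₀ a
    refine ⟨f₀, hf₀, ?_⟩
    convert ha using 1
    simp only [g, map_prod, eval_rename]
    refine Finset.prod_congr rfl fun e _ => ?_
    congr 2
    funext x
    exact hc x.1 _ ((degree_mapDomain_equiv e _).trans (mon_degree _))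
  · intro f hf hne
    refine dim_of_cover δ (fun e => chartSet e (fanoLines (projZeroLocus f))) e₀
      (fun e => isOpen_chartSet e _) (fun W => exists_chart rfl W.1) fun e => ?_
    refine (chart_dim hd f hf e).trans (hdim _ ?_)
    simp only [g, map_prod, eval_rename] at hne
    have h1 := Finset.prod_ne_zero_iff.mp hne e (Finset.mem_univ _)
    convert h1 using 3
    funext x
    exact (coeff_idx d e x f).symm

end helpers

/-- **Proposition.**  If `d_i ≥ 2` for all `i` and `d := Σ d_i ≤ 2n − s − 2`, then for a
general tuple `(f_1, …, f_s)` in `⊕_i Sym^{d_i}(V*)`, the variety `X = V(f_1, …, f_s) ⊆ ℙ^n`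
has Fano variety of lines of dimension exactly `2n − d − s − 2`. -/
theorem dim_fanoLines_of_general
    (n s : ℕ) (d : Fin s → ℕ) (hd : ∀ i, 2 ≤ d i)
    (hle : ∑ i, d i + s + 2 ≤ 2 * n) :
    GenericHolds n d (fun f =>
      topologicalKrullDim ↥(fanoLines (projZeroLocus f)) =
        ((2 * n - ∑ i, d i - s - 2 : ℕ) : WithBot ℕ∞)) := by
  exact main_thm n s d hd hle

end
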